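/- arXiv:1609.01877 — 3 statements merged into one kernel-verified Lean document; each statement's English description precedes it below -/
import Mathlib

section
/- For every integer k with 2 ≤ k ≤ n−1, the projective zero locus X_k(K) ⊆ ℙ^k(K) of the ideal I_{X_k} is a finite set (i.e., the scheme X_k is zero-dimensional or empty). -/
open MvPolynomial

noncomputable section

/-- The coefficient `a_i` of `s^(n-i) t^i` in a binary form `f` of degree `n`. -/
def bcoeff {K : Type*} [Field K] (n : ℕ) (f : MvPolynomial (Fin 2) K) (i : Fin (n + 1)) : K :=
  MvPolynomial.coeff (Finsupp.single 0 (n - (i : ℕ)) + Finsupp.single 1 (i : ℕ)) f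

/-- The binary form of degree `k` with coefficient vector `x`. -/
def formOf {K : Type*} [Field K] (k : ℕ) (x : Fin (k + 1) → K) : MvPolynomial (Fin 2) K :=
  ∑ i : Fin (k + 1),
    MvPolynomial.C (x i) * MvPolynomial.X 0 ^ (k - (i : ℕ)) * MvPolynomial.X 1 ^ (i : ℕ)

/-- The matrix `M_k` associated to the parameterization `f`: the first `n-k+1` rows contain
the variables `x_0, …, x_k` in staircase position, the last three rows are the coefficient
vectors of `f_0, f_1, f_2`. -/
def Mmat {K : Type*} [Field K] (n k : ℕ) (f : Fin 3 → MvPolynomial (Fin 2) K) :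
    Matrix (Fin (n - k + 4)) (Fin (n + 1)) (MvPolynomial (Fin (k + 1)) K) :=
  fun j c =>
    if hj : (j : ℕ) ≤ n - k then
      if h : (j : ℕ) ≤ (c : ℕ) ∧ (c : ℕ) ≤ (j : ℕ) + k then
        MvPolynomial.X ⟨(c : ℕ) - (j : ℕ), by omega⟩
      else 0
    else
      MvPolynomial.C (bcoeff n (f ⟨(j : ℕ) - (n - k + 1), by have := j.isLt; omega⟩) c)

/-- The set of `(n-k+3) × (n-k+3)` minors of the matrix `M_k`; it generates the ideal
`I_{X_k}`. -/
def minorsSet {K : Type*} [Field K] (n k : ℕ) (f : Fin 3 → MvPolynomial (Fin 2) K) :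
    Set (MvPolynomial (Fin (k + 1)) K) :=
  { g | ∃ (r : Fin (n - k + 3) → Fin (n - k + 4)) (c : Fin (n - k + 3) → Fin (n + 1)),
      Function.Injective r ∧ Function.Injective c ∧
      g = ((Mmat n k f).submatrix r c).det }

/-- The projective zero locus `X_k(K) ⊆ ℙ^k(K)` of the ideal of minors of `M_k`. -/
def XkSet {K : Type*} [Field K] (n k : ℕ) (f : Fin 3 → MvPolynomial (Fin 2) K) :
    Set (Projectivization K (Fin (k + 1) → K)) :=
  { P | ∀ g ∈ minorsSet n k f, MvPolynomial.eval P.rep g = 0 }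

/-- Evaluation of the parameterization at a vector `v ∈ K²`. -/
def evalVec {K : Type*} [Field K] (f : Fin 3 → MvPolynomial (Fin 2) K) (v : Fin 2 → K) :
    Fin 3 → K :=
  fun u => MvPolynomial.eval v (f u)

/-- The induced map `f : ℙ¹(K) → ℙ²(K)` (with a junk value where undefined). -/
def projMap {K : Type*} [Field K] (f : Fin 3 → MvPolynomial (Fin 2) K)
    (P : Projectivization K (Fin 2 → K)) : Projectivization K (Fin 3 → K) :=
  haveI := Classical.propDecidable (evalVec f P.rep ≠ 0)
  if h : evalVec f P.rep ≠ 0 then Projectivization.mk K _ h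
  else Projectivization.mk K (fun _ => 1) (fun hc => one_ne_zero (congrFun hc 0))

/-- `f = (f_0, f_1, f_2)` is a proper parameterization of degree `n`: the `f_u` are
homogeneous of degree `n`, have no common zero outside the origin, and the induced map
`ℙ¹(K) → ℙ²(K)` is injective outside some finite set. -/
structure IsProperParam {K : Type*} [Field K] (n : ℕ)
    (f : Fin 3 → MvPolynomial (Fin 2) K) : Prop where
  homog : ∀ u, (f u).IsHomogeneous n
  no_common_zero : ∀ v : Fin 2 → K, v ≠ 0 → evalVec f v ≠ 0
  gen_injective : ∃ S : Set (Projectivization K (Fin 2 → K)), S.Finite ∧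
    Set.InjOn (projMap f) Sᶜ

/-- The homogeneous vanishing ideal of the point `p ∈ ℙ²(K)`. -/
def pointIdeal {K : Type*} [Field K] (p : Fin 3 → K) : Ideal (MvPolynomial (Fin 3) K) :=
  Ideal.span { L | L.IsHomogeneous 1 ∧ MvPolynomial.eval p L = 0 }

/-- The multiplicity of the curve `{F = 0}` at the point `p`:
the largest `m` with `F ∈ I(p)^m`. -/
def multAt {K : Type*} [Field K] (F : MvPolynomial (Fin 3) K) (p : Fin 3 → K) : ℕ :=
  sSup { m | F ∈ pointIdeal p ^ m }

/-- The cross difference `p_i f_j - p_j f_i`. -/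
def crossDiff {K : Type*} [Field K] (f : Fin 3 → MvPolynomial (Fin 2) K) (p : Fin 3 → K)
    (i j : Fin 3) : MvPolynomial (Fin 2) K :=
  MvPolynomial.C (p i) * f j - MvPolynomial.C (p j) * f i

/-- `G` is a greatest common divisor of the three cross differences `p_i f_j - p_j f_i`,
`0 ≤ i < j ≤ 2`. -/
def IsGcdOfCross {K : Type*} [Field K] (f : Fin 3 → MvPolynomial (Fin 2) K) (p : Fin 3 → K)
    (G : MvPolynomial (Fin 2) K) : Prop :=
  (∀ i j : Fin 3, i < j → G ∣ crossDiff f p i j) ∧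
  (∀ D : MvPolynomial (Fin 2) K, (∀ i j : Fin 3, i < j → D ∣ crossDiff f p i j) → D ∣ G)

/-- The linear binary form with root `v = (v 0 : v 1)`. -/
def linFormOf {K : Type*} [Field K] (v : Fin 2 → K) : MvPolynomial (Fin 2) K :=
  MvPolynomial.C (v 1) * MvPolynomial.X 0 - MvPolynomial.C (v 0) * MvPolynomial.X 1

/-- The multiplicity of `v` as a root of the binary form `h`. -/
def ordAt {K : Type*} [Field K] (v : Fin 2 → K) (h : MvPolynomial (Fin 2) K) : ℕ :=
  sSup { e | linFormOf v ^ e ∣ h }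

/-- The point `x ∈ ℙ²` lies on the conic `4 x₀ x₂ - x₁² = 0`. -/
def onConic {K : Type*} [Field K] (x : Fin 3 → K) : Prop :=
  4 * x 0 * x 2 - x 1 ^ 2 = 0


lemma aux_rows {K : Type*} [Field K] {a b m : ℕ} (A : Matrix (Fin a) (Fin b) K)
    (h : m ≤ A.rank) : ∃ r : Fin m → Fin a, Function.Injective r ∧
      LinearIndependent K (fun i => A (r i)) := by
  obtain ⟨κ, e, he, hs, hl⟩ := exists_linearIndependent' K (fun i => A i)
  have : Finite κ := Finite.of_injective e he
  have := Fintype.ofFinite κ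
  have hc : Fintype.card κ = A.rank := by
    rw [A.rank_eq_finrank_span_row, ← finrank_span_eq_card hl, hs]
    rfl
  have emb : Nonempty (Fin m ↪ κ) := by
    apply Function.Embedding.nonempty_of_card_le
    simp [hc, h]
  obtain ⟨g⟩ := emb
  exact ⟨e ∘ g, he.comp g.injective, hl.comp g g.injective⟩

lemma aux_minor {K : Type*} [Field K] {a b m : ℕ} (A : Matrix (Fin a) (Fin b) K)
    (h : m ≤ A.rank) : ∃ (r : Fin m → Fin a) (c : Fin m → Fin b), Function.Injective r ∧
      Function.Injective c ∧ (A.submatrix r c).det ≠ 0 := by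
  obtain ⟨r, hr, hl⟩ := aux_rows A h
  have h2 : m ≤ (A.submatrix r id).transpose.rank := by
    rw [Matrix.rank_transpose]
    have := LinearIndependent.rank_matrix (M := A.submatrix r id) hl
    simp [this]
  obtain ⟨c, hc, hl2⟩ := aux_rows _ h2
  refine ⟨r, c, hr, hc, ?_⟩
  have : IsUnit (A.submatrix r c).transpose :=
    Matrix.linearIndependent_rows_iff_isUnit.mp hl2
  rw [Matrix.isUnit_iff_isUnit_det, Matrix.det_transpose] at this
  exact this.ne_zero

/-- Two vectors killed by a two-dimensional space of functionals are proportional. -/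
lemma aux_prop {K : Type*} [Field K] (L : Submodule K (Fin 3 → K))
    (hL : 2 ≤ Module.finrank K L) (w z : Fin 3 → K)
    (hw : ∀ α ∈ L, ∑ u, α u * w u = 0) (hz : ∀ α ∈ L, ∑ u, α u * z u = 0) (i j : Fin 3) :
    w i * z j = w j * z i := by
  by_contra hne
  have hli : LinearIndependent K ![w, z] := by
    rw [LinearIndependent.pair_iff]
    intro s t hst
    have hi := congrFun hst i
    have hj := congrFun hst j
    simp only [Pi.add_apply, Pi.smul_apply, smul_eq_mul, Pi.zero_apply] at hi hj
    have hne' : w i * z j - w j * z i ≠ 0 := sub_ne_zero.mpr hne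
    constructor
    · have : s * (w i * z j - w j * z i) = 0 := by linear_combination z j * hi - z i * hj
      exact (mul_eq_zero.mp this).resolve_right hne'
    · have : t * (w i * z j - w j * z i) = 0 := by linear_combination w i * hj - w j * hi
      exact (mul_eq_zero.mp this).resolve_right hne'
  let N : Matrix (Fin 2) (Fin 3) K := ![w, z]
  have hr : N.rank = 2 := by
    have := LinearIndependent.rank_matrix (M := N) hli
    simpa using this
  have hle : L ≤ LinearMap.ker N.mulVecLin := by
    intro α hα
    rw [LinearMap.mem_ker]
    ext q
    fin_cases q
    · have := hw α hα
      simp only [mul_comm (α _)] at this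
      exact this
    · have := hz α hα
      simp only [mul_comm (α _)] at this
      exact this
  have h1 := Submodule.finrank_mono hle
  have h2 := LinearMap.finrank_range_add_finrank_ker N.mulVecLin
  rw [show Module.finrank K (LinearMap.range N.mulVecLin) = 2 from hr] at h2
  simp at h2
  omega

/-- Univariate polynomial with given coefficient vector. -/
def upoly {K : Type*} [Field K] (k : ℕ) (x : Fin (k + 1) → K) : Polynomial K :=
  ∑ i : Fin (k + 1), Polynomial.C (x i) * Polynomial.X ^ (i : ℕ)

lemma upoly_coeff {K : Type*} [Field K] (k : ℕ) (x : Fin (k + 1) → K) (m : ℕ) :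
    (upoly k x).coeff m = if h : m < k + 1 then x ⟨m, h⟩ else 0 := by
  simp only [upoly, Polynomial.finsetSum_coeff, Polynomial.coeff_C_mul, Polynomial.coeff_X_pow]
  split_ifs with h
  · rw [Finset.sum_eq_single ⟨m, h⟩]
    · simp
    · intro b _ hb
      have : m ≠ (b : ℕ) := fun hh => hb (Fin.ext hh.symm)
      simp [this]
    · simp
  · apply Finset.sum_eq_zero
    intro b _
    have : m ≠ (b : ℕ) := by omega
    simp [this]

lemma form_eq {K : Type*} [Field K] (n : ℕ) (f : MvPolynomial (Fin 2) K)
    (hf : f.IsHomogeneous n) : f = formOf n (bcoeff n f) := by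
  ext d
  have hform : ∀ i : Fin (n + 1), MvPolynomial.C (bcoeff n f i) *
      MvPolynomial.X (0 : Fin 2) ^ (n - (i : ℕ)) * MvPolynomial.X 1 ^ (i : ℕ) =
      MvPolynomial.monomial (Finsupp.single 0 (n - (i : ℕ)) + Finsupp.single 1 (i : ℕ))
        (bcoeff n f i) := by
    intro i
    rw [MvPolynomial.X_pow_eq_monomial, MvPolynomial.X_pow_eq_monomial,
      MvPolynomial.C_mul_monomial, MvPolynomial.monomial_mul]
    simp
  simp only [formOf, hform, MvPolynomial.coeff_sum, MvPolynomial.coeff_monomial]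
  by_cases hd : d 0 + d 1 = n
  · have hlt : d 1 < n + 1 := by omega
    rw [Finset.sum_eq_single ⟨d 1, hlt⟩]
    · have hdd : Finsupp.single 0 (n - d 1) + Finsupp.single 1 (d 1) = d := by
        ext q
        fin_cases q
        · simp; omega
        · simp
      simp only [bcoeff, hdd, if_true]
    · intro b _ hb
      rw [if_neg]
      intro hh
      apply hb
      have := DFunLike.congr_fun hh 1
      simp at this
      exact Fin.ext this
    · simp
  · rw [Finset.sum_eq_zero]
    · by_contra hne
      apply hd
      have := hf hne
      rw [← this, Finsupp.weight_apply, Finsupp.sum_fintype _ _ (by simp)]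
      simp
    · intro b _
      rw [if_neg]
      intro hh
      apply hd
      have h0 := DFunLike.congr_fun hh 0
      have h1 := DFunLike.congr_fun hh 1
      simp at h0 h1
      omega

lemma eval_fin {K : Type*} [Field K] (n : ℕ) (f : MvPolynomial (Fin 2) K)
    (hf : f.IsHomogeneous n) (t : K) :
    MvPolynomial.eval ![1, t] f = (upoly n (bcoeff n f)).eval t := by
  conv_lhs => rw [form_eq n f hf]
  simp [formOf, upoly, Polynomial.eval_finsetSum]

lemma eval_inf {K : Type*} [Field K] (n : ℕ) (f : MvPolynomial (Fin 2) K)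
    (hf : f.IsHomogeneous n) :
    MvPolynomial.eval ![0, 1] f = bcoeff n f (Fin.last n) := by
  conv_lhs => rw [form_eq n f hf]
  simp only [formOf, map_sum, map_mul, map_pow, MvPolynomial.eval_C, MvPolynomial.eval_X]
  rw [Finset.sum_eq_single (Fin.last n)]
  · simp
  · intro b _ hb
    have : n - (b : ℕ) ≠ 0 := by
      have := b.isLt
      have : (b : ℕ) ≠ n := fun h => hb (Fin.ext h)
      omega
    simp [this]
  · simp

lemma eval_scale {K : Type*} [Field K] (n : ℕ) (f : MvPolynomial (Fin 2) K)
    (hf : f.IsHomogeneous n) (a : K) (v : Fin 2 → K) :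
    MvPolynomial.eval (a • v) f = a ^ n * MvPolynomial.eval v f := by
  rw [form_eq n f hf]
  simp only [formOf, map_sum, map_mul, map_pow, MvPolynomial.eval_C, MvPolynomial.eval_X,
    Finset.mul_sum, Pi.smul_apply, smul_eq_mul]
  apply Finset.sum_congr rfl
  intro i _
  have : n = (n - (i : ℕ)) + i := by omega
  conv_rhs => rw [show a ^ n = a ^ (n - (i : ℕ)) * a ^ (i : ℕ) by rw [← pow_add, ← this]]
  ring

lemma projMap_mk {K : Type*} [Field K] (n : ℕ) (f : Fin 3 → MvPolynomial (Fin 2) K)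
    (hf : IsProperParam n f) (v : Fin 2 → K) (hv : v ≠ 0) :
    projMap f (Projectivization.mk K v hv) =
      Projectivization.mk K (evalVec f v) (hf.no_common_zero v hv) := by
  have h1 := hf.no_common_zero _ (Projectivization.mk K v hv).rep_nonzero
  unfold projMap
  rw [dif_pos h1, Projectivization.mk_eq_mk_iff']
  obtain ⟨a, ha⟩ := Projectivization.exists_smul_eq_mk_rep K v hv
  refine ⟨(a : K) ^ n, ?_⟩
  rw [← ha]
  funext u
  exact (eval_scale n (f u) (hf.homog u) a v).symm

lemma mk_eq_of_prop {K : Type*} [Field K] (w z : Fin 3 → K) (hw : w ≠ 0) (hz : z ≠ 0)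
    (h : ∀ i j, w i * z j = w j * z i) :
    Projectivization.mk K w hw = Projectivization.mk K z hz := by
  rw [Projectivization.mk_eq_mk_iff']
  obtain ⟨j, hj⟩ := Function.ne_iff.mp hz
  refine ⟨w j / z j, ?_⟩
  funext i
  have hj' : z j ≠ 0 := hj
  simp only [Pi.smul_apply, smul_eq_mul]
  field_simp
  linear_combination -(h i j)

/-- The space of combinations divisible by the form. -/
lemma aux_kernel {K : Type*} [Field K] (n k : ℕ) (hk : k ≤ n)
    (f : Fin 3 → MvPolynomial (Fin 2) K) (x : Fin (k + 1) → K) (hx : x ≠ 0)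
    (hm : ∀ g ∈ minorsSet n k f, MvPolynomial.eval x g = 0) :
    ∃ L : Submodule K (Fin 3 → K), 2 ≤ Module.finrank K L ∧ ∀ α ∈ L,
      upoly k x ∣ (∑ u, Polynomial.C (α u) * upoly n (bcoeff n (f u))) ∧
      (x (Fin.last k) = 0 → ∑ u, α u * bcoeff n (f u) (Fin.last n) = 0) := by
  let A : Matrix (Fin (n - k + 4)) (Fin (n + 1)) K := (Mmat n k f).map (MvPolynomial.eval x)
  have hrank : A.rank ≤ n - k + 2 := by
    by_contra hcon
    obtain ⟨r, c, hr, hc, hdet⟩ := aux_minor (m := n - k + 3) A (by omega)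
    apply hdet
    have := hm _ ⟨r, c, hr, hc, rfl⟩
    rw [RingHom.map_det] at this
    exact this
  have hker : 2 ≤ Module.finrank K (LinearMap.ker A.transpose.mulVecLin) := by
    have h2 := LinearMap.finrank_range_add_finrank_ker A.transpose.mulVecLin
    rw [show Module.finrank K (LinearMap.range A.transpose.mulVecLin) = A.rank from
      A.rank_transpose] at h2
    simp at h2
    omega
  -- polynomial rows
  have e : n - k + 1 + 3 = n - k + 4 := rfl
  let lo : Fin (n - k + 1) → Fin (n - k + 4) := Fin.castAdd 3
  let hi : Fin 3 → Fin (n - k + 4) := Fin.natAdd (n - k + 1)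
  have hlo : ∀ (j : Fin (n - k + 1)) (c : Fin (n + 1)),
      A (lo j) c = (Polynomial.X ^ (j : ℕ) * upoly k x).coeff c := by
    intro j c
    have hj := j.isLt
    rw [Polynomial.coeff_X_pow_mul', upoly_coeff]
    have h1 : ((lo j : Fin (n - k + 4)) : ℕ) = j := rfl
    simp only [A, Matrix.map_apply, Mmat, h1]
    rw [dif_pos (by omega)]
    by_cases h2 : (j : ℕ) ≤ c
    · by_cases h3 : (c : ℕ) ≤ j + k
      · rw [dif_pos ⟨h2, h3⟩, if_pos h2, dif_pos (by omega)]
        simp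
      · rw [dif_neg (by tauto), if_pos h2, dif_neg (by omega)]
        simp
    · rw [dif_neg (by tauto), if_neg h2]
      simp
  have hhi : ∀ (u : Fin 3) (c : Fin (n + 1)), A (hi u) c = bcoeff n (f u) c := by
    intro u c
    have h1 : ((hi u : Fin (n - k + 4)) : ℕ) = n - k + 1 + u := rfl
    simp only [A, Matrix.map_apply, Mmat, h1]
    rw [dif_neg (by omega)]
    simp
  have hsum : ∀ v ∈ LinearMap.ker A.transpose.mulVecLin, ∀ c : Fin (n + 1),
      (∑ j, v (lo j) * (Polynomial.X ^ (j : ℕ) * upoly k x).coeff c) +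
        ∑ u, v (hi u) * bcoeff n (f u) c = 0 := by
    intro v hv c
    have := congrFun (LinearMap.mem_ker.mp hv) c
    simp only [Matrix.mulVecLin_apply, Matrix.mulVec, dotProduct, Matrix.transpose_apply,
      Pi.zero_apply] at this
    have h2 := Fin.sum_univ_add (a := n - k + 1) (b := 3) (fun i : Fin (n - k + 4) => A i c * v i)
    rw [← this, h2]
    congr 1
    · exact Finset.sum_congr rfl fun j _ => by rw [← hlo j c, mul_comm]
    · exact Finset.sum_congr rfl fun j _ => by rw [← hhi j c, mul_comm]
  have hpoly : ∀ v ∈ LinearMap.ker A.transpose.mulVecLin,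
      (∑ j, Polynomial.C (v (lo j)) * Polynomial.X ^ (j : ℕ)) * upoly k x +
        ∑ u, Polynomial.C (v (hi u)) * upoly n (bcoeff n (f u)) = 0 := by
    intro v hv
    ext c
    simp only [Finset.sum_mul, mul_assoc, Polynomial.coeff_add, Polynomial.finsetSum_coeff,
      Polynomial.coeff_C_mul, Polynomial.coeff_zero]
    by_cases hc : c < n + 1
    · rw [← hsum v hv ⟨c, hc⟩]
      congr 1
      exact Finset.sum_congr rfl fun u _ => by rw [upoly_coeff, dif_pos hc]
    · rw [Finset.sum_eq_zero, Finset.sum_eq_zero, add_zero]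
      · intro u _
        rw [upoly_coeff, dif_neg hc, mul_zero]
      · intro j _
        have := j.isLt
        rw [Polynomial.coeff_X_pow_mul', if_pos (by omega), upoly_coeff, dif_neg (by omega),
          mul_zero]
  have hG : upoly k x ≠ 0 := by
    intro h0
    apply hx
    funext i
    have := upoly_coeff k x i
    rw [h0, dif_pos i.isLt] at this
    simpa using this.symm
  let π : (Fin (n - k + 4) → K) →ₗ[K] (Fin 3 → K) := LinearMap.funLeft K K hi
  have hinj : Function.Injective (π.domRestrict (LinearMap.ker A.transpose.mulVecLin)) := by
    rw [← LinearMap.ker_eq_bot, LinearMap.ker_eq_bot']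
    rintro ⟨v, hv⟩ h0
    have h0' : ∀ u, v (hi u) = 0 := fun u => congrFun h0 u
    have hp := hpoly v hv
    simp only [h0', map_zero, zero_mul, Finset.sum_const_zero, add_zero] at hp
    have hq := (mul_eq_zero.mp hp).resolve_right hG
    have hq' : ∀ j, v (lo j) = 0 := by
      intro j
      have := upoly_coeff (n - k) (fun j => v (lo j)) j
      rw [dif_pos j.isLt] at this
      rw [show upoly (n - k) (fun j => v (lo j)) = 0 from hq] at this
      simpa using this.symm
    apply Subtype.ext
    funext i
    refine Fin.addCases (m := n - k + 1) (n := 3) (motive := fun i => v i = 0) hq' h0' i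
  refine ⟨LinearMap.range (π.domRestrict (LinearMap.ker A.transpose.mulVecLin)), ?_, ?_⟩
  · rw [LinearMap.finrank_range_of_inj hinj]
    exact hker
  · rintro α ⟨⟨v, hv⟩, rfl⟩
    have hα : ∀ u, (π.domRestrict (LinearMap.ker A.transpose.mulVecLin)) ⟨v, hv⟩ u = v (hi u) :=
      fun u => rfl
    simp only [hα]
    constructor
    · rw [← dvd_add_right (Dvd.intro_left _ rfl), hpoly v hv]
      exact dvd_zero _
    · intro hx0
      rw [← hsum v hv (Fin.last n)]
      symm
      rw [add_eq_right]
      apply Finset.sum_eq_zero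
      intro j _
      have := j.isLt
      rw [Polynomial.coeff_X_pow_mul', Fin.val_last, if_pos (by omega), upoly_coeff]
      split_ifs with h
      · have hjj : (⟨n - j, h⟩ : Fin (k + 1)) = Fin.last k := Fin.ext (by simp; omega)
        rw [hjj, hx0, mul_zero]
      · simp

/-- The affine point `(1 : t)`. -/
def pt {K : Type*} [Field K] (t : K) : Projectivization K (Fin 2 → K) :=
  Projectivization.mk K ![1, t] (fun h => one_ne_zero (congrFun h 0))

lemma pt_inj {K : Type*} [Field K] : Function.Injective (pt (K := K)) := by
  intro a b h
  unfold pt at h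
  rw [Projectivization.mk_eq_mk_iff'] at h
  obtain ⟨c, hc⟩ := h
  have h0 := congrFun hc 0
  have h1 := congrFun hc 1
  simp at h0 h1
  rw [← h1, h0, one_mul]

lemma fiber_finite {K : Type*} [Field K] (n : ℕ) (f : Fin 3 → MvPolynomial (Fin 2) K)
    (hf : IsProperParam n f) (Q : Projectivization K (Fin 3 → K)) :
    {t : K | projMap f (pt t) = Q}.Finite := by
  obtain ⟨S, hS, hinj⟩ := hf.gen_injective
  have h1 : (Set.preimage pt S : Set K).Finite := hS.preimage pt_inj.injOn
  have h2 : {t : K | pt t ∉ S ∧ projMap f (pt t) = Q}.Finite := by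
    apply Set.Subsingleton.finite
    rintro a ⟨ha, ha'⟩ b ⟨hb, hb'⟩
    exact pt_inj (hinj ha hb (ha'.trans hb'.symm))
  refine (h1.union h2).subset ?_
  intro t ht
  by_cases h : pt t ∈ S
  · exact Or.inl h
  · exact Or.inr ⟨h, ht⟩

lemma wronsk {K : Type*} [Field K] [CharZero K] (p q : Polynomial K)
    (h : p * Polynomial.derivative q = q * Polynomial.derivative p) (t : K)
    (hp : p.eval t = 0) (hq : q.eval t ≠ 0) : p = 0 := by
  by_contra hne
  have hq0 : q ≠ 0 := fun h0 => hq (by simp [h0])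
  have hroot : p.IsRoot t := hp
  have hm := (Polynomial.rootMultiplicity_pos hne).mpr hroot
  have hd := Polynomial.derivative_rootMultiplicity_of_root hroot
  have hqm : q.rootMultiplicity t = 0 := Polynomial.rootMultiplicity_eq_zero hq
  have hdp : Polynomial.derivative p ≠ 0 := by
    intro h0
    have := Polynomial.natDegree_eq_zero_of_derivative_eq_zero h0
    rw [Polynomial.eq_C_of_natDegree_eq_zero this] at hp hne
    simp at hp hne
    exact hne hp
  have hdq : Polynomial.derivative q ≠ 0 := by
    intro h0
    rw [h0, mul_zero] at h
    exact (mul_ne_zero hq0 hdp) h.symm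
  have := congrArg (Polynomial.rootMultiplicity t) h
  rw [Polynomial.rootMultiplicity_mul (mul_ne_zero hne hdq),
    Polynomial.rootMultiplicity_mul (mul_ne_zero hq0 hdp)] at this
  omega

lemma ram_finite {K : Type*} [Field K] [CharZero K] (n : ℕ)
    (f : Fin 3 → MvPolynomial (Fin 2) K) (hf : IsProperParam n f)
    (F : Fin 3 → Polynomial K) (hF : ∀ u t, MvPolynomial.eval ![1, t] (f u) = (F u).eval t) :
    {t : K | ∀ i j, (F i).eval t * (Polynomial.derivative (F j)).eval t =
      (F j).eval t * (Polynomial.derivative (F i)).eval t}.Finite := by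
  by_cases hW : ∃ i j, F i * Polynomial.derivative (F j) - F j * Polynomial.derivative (F i) ≠ 0
  · obtain ⟨i, j, hij⟩ := hW
    refine (Polynomial.finite_setOf_isRoot hij).subset ?_
    intro t ht
    have := ht i j
    simp [Polynomial.IsRoot, this]
  · exfalso
    push Not at hW
    have hv : ∀ t : K, (![1, t] : Fin 2 → K) ≠ 0 := fun t h => one_ne_zero (congrFun h 0)
    obtain ⟨j, hj⟩ := Function.ne_iff.mp (hf.no_common_zero _ (hv 0))
    have hj' : (F j).eval 0 ≠ 0 := by
      rw [← hF]
      exact hj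
    have hc : ∀ i, F i = Polynomial.C ((F i).eval 0 / (F j).eval 0) * F j := by
      intro i
      rw [← sub_eq_zero]
      apply wronsk _ (F j) _ 0 _ hj'
      · simp only [Polynomial.derivative_sub, Polynomial.derivative_C_mul]
        linear_combination hW i j
      · simp [hj']
    have huniv := fiber_finite n f hf (projMap f (pt 0))
    apply Set.infinite_univ (α := K)
    refine huniv.subset ?_
    intro t _
    show projMap f (pt t) = projMap f (pt 0)
    unfold pt
    rw [projMap_mk n f hf, projMap_mk n f hf]
    apply mk_eq_of_prop
    intro a b
    simp only [evalVec, hF]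
    conv_lhs => rw [hc a]
    conv_rhs => rw [hc b]
    simp
    field_simp

lemma root_finite {K : Type*} [Field K] [IsAlgClosed K] [CharZero K]
    (n : ℕ) (f : Fin 3 → MvPolynomial (Fin 2) K)
    (hf : IsProperParam n f) (k : ℕ) (hk2 : 2 ≤ k) (hk : k ≤ n) :
    ∃ T : Finset K, ∀ P ∈ XkSet n k f, ∀ t ∈ (upoly k P.rep).roots, t ∈ T := by
  classical
  obtain ⟨S, hS, hinj⟩ := hf.gen_injective
  let F : Fin 3 → Polynomial K := fun u => upoly n (bcoeff n (f u))
  have hF : ∀ u t, MvPolynomial.eval ![1, t] (f u) = (F u).eval t :=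
    fun u t => eval_fin n (f u) (hf.homog u) t
  have hinf : (![0, 1] : Fin 2 → K) ≠ 0 := fun h => one_ne_zero (congrFun h 1)
  have hv : ∀ t : K, (![1, t] : Fin 2 → K) ≠ 0 := fun t h => one_ne_zero (congrFun h 0)
  have f1 : (Set.preimage pt S : Set K).Finite := hS.preimage pt_inj.injOn
  have f2 : (⋃ Q ∈ S, {t : K | projMap f (pt t) = projMap f Q}).Finite :=
    hS.biUnion fun Q _ => fiber_finite n f hf _
  have f3 := fiber_finite n f hf (projMap f (Projectivization.mk K ![0, 1] hinf))
  have f4 := ram_finite n f hf F hF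
  refine ⟨((f1.union f2).union (f3.union f4)).toFinset, ?_⟩
  intro P hP t ht
  rw [Set.Finite.mem_toFinset]
  obtain ⟨L, hL, hLd⟩ := aux_kernel n k hk f P.rep P.rep_nonzero hP
  set G := upoly k P.rep with hGdef
  have hG : G ≠ 0 := fun h0 => by simp [h0] at ht
  have hLt : ∀ s, G.IsRoot s → ∀ α ∈ L, ∑ u, α u * (F u).eval s = 0 := by
    intro s hs α hα
    obtain ⟨H, hH⟩ := (hLd α hα).1
    have := congrArg (Polynomial.eval s) hH
    rw [Polynomial.eval_mul, show G.eval s = 0 from hs, zero_mul] at this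
    simpa [Polynomial.eval_finsetSum] using this
  have hroot : G.IsRoot t := Polynomial.isRoot_of_mem_roots ht
  by_cases hmult : 1 < G.rootMultiplicity t
  · right; right
    have hd := ((Polynomial.one_lt_rootMultiplicity_iff_isRoot hG).mp hmult).2
    have hLd' : ∀ α ∈ L, ∑ u, α u * (Polynomial.derivative (F u)).eval t = 0 := by
      intro α hα
      obtain ⟨H, hH⟩ := (hLd α hα).1
      have := congrArg (fun p => Polynomial.eval t (Polynomial.derivative p)) hH
      simp only [Polynomial.derivative_mul, Polynomial.eval_add, Polynomial.eval_mul] at this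
      rw [show G.eval t = 0 from hroot, show (Polynomial.derivative G).eval t = 0 from hd] at this
      simpa [Polynomial.eval_finsetSum] using this
    intro i j
    exact aux_prop L hL (fun u => (F u).eval t) (fun u => (Polynomial.derivative (F u)).eval t)
      (hLt t hroot) hLd' i j
  by_cases hother : ∃ s, G.IsRoot s ∧ s ≠ t
  · obtain ⟨s, hs, hst⟩ := hother
    have heq : projMap f (pt t) = projMap f (pt s) := by
      unfold pt
      rw [projMap_mk n f hf, projMap_mk n f hf]
      apply mk_eq_of_prop
      intro i j
      simp only [evalVec, hF]
      exact aux_prop L hL (fun u => (F u).eval t) (fun u => (F u).eval s)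
        (hLt t hroot) (hLt s hs) i j
    left
    by_cases htS : pt t ∈ S
    · exact Or.inl htS
    · by_cases hsS : pt s ∈ S
      · right
        exact Set.mem_biUnion hsS heq
      · exact absurd (pt_inj (hinj htS hsS heq)).symm hst
  · push Not at hother
    right; left
    have hroots : G.roots = {t} := by
      have hall : ∀ s ∈ G.roots, s = t := fun s hs => hother s (Polynomial.isRoot_of_mem_roots hs)
      have hrep := Multiset.eq_replicate_card.mpr hall
      have hcount : G.roots.count t = Multiset.card G.roots := Multiset.count_eq_card.mpr
        fun s hs => (hall s hs).symm
      rw [Polynomial.count_roots] at hcount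
      have hpos := (Polynomial.rootMultiplicity_pos hG).mpr hroot
      rw [hrep, ← hcount, show G.rootMultiplicity t = 1 by omega]
      simp
    have hdeg : G.natDegree = 1 := by
      rw [(IsAlgClosed.splits G).natDegree_eq_card_roots, hroots]
      simp
    have hx0 : P.rep (Fin.last k) = 0 := by
      have h1 := upoly_coeff k P.rep k
      rw [dif_pos (Nat.lt_succ_self k), ← hGdef,
        Polynomial.coeff_eq_zero_of_natDegree_lt (by omega)] at h1
      exact h1.symm
    show projMap f (pt t) = _
    unfold pt
    rw [projMap_mk n f hf, projMap_mk n f hf]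
    apply mk_eq_of_prop
    intro i j
    have hin : ∀ u, evalVec f ![0, 1] u = bcoeff n (f u) (Fin.last n) :=
      fun u => eval_inf n (f u) (hf.homog u)
    rw [hin, hin]
    simp only [evalVec, hF]
    exact aux_prop L hL (fun u => (F u).eval t) (fun u => bcoeff n (f u) (Fin.last n))
      (hLt t hroot) (fun α hα => (hLd α hα).2 hx0) i j

/-- For every `2 ≤ k ≤ n-1`, the projective zero locus `X_k(K) ⊆ ℙ^k(K)` of the ideal
`I_{X_k}` is a finite set. -/
theorem statement_0 {K : Type*} [Field K] [IsAlgClosed K] [CharZero K]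
    (n : ℕ) (hn : 3 ≤ n) (f : Fin 3 → MvPolynomial (Fin 2) K)
    (hf : IsProperParam n f) :
    ∀ k : ℕ, 2 ≤ k → k ≤ n - 1 → (XkSet n k f).Finite := by
  intro k hk2 hkn
  classical
  obtain ⟨T, hT⟩ := root_finite n f hf k hk2 (by omega)
  let Φ : Projectivization K (Fin (k + 1) → K) → Multiset K := fun P => (upoly k P.rep).roots
  have hdeg : ∀ x : Fin (k + 1) → K, (upoly k x).natDegree ≤ k := by
    intro x
    rw [Polynomial.natDegree_le_iff_coeff_eq_zero]
    intro m hm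
    rw [upoly_coeff, dif_neg (by omega)]
  have hcoeff : ∀ (x : Fin (k + 1) → K) (i : Fin (k + 1)), (upoly k x).coeff i = x i := by
    intro x i
    rw [upoly_coeff, dif_pos i.isLt]
  have himg : (Set.image Φ (XkSet n k f)).Finite := by
    refine (Set.finite_Icc (0 : Multiset K) (k • T.val)).subset ?_
    rintro _ ⟨P, hP, rfl⟩
    refine ⟨Multiset.zero_le _, ?_⟩
    rw [Multiset.le_iff_count]
    intro a
    by_cases ha : a ∈ Φ P
    · have haT := hT P hP a ha
      rw [Multiset.count_nsmul, Multiset.count_eq_one_of_mem T.nodup haT, mul_one]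
      exact (Multiset.count_le_card _ _).trans ((Polynomial.card_roots' _).trans (hdeg _))
    · rw [Multiset.count_eq_zero_of_notMem ha]
      exact Nat.zero_le _
  refine Set.Finite.of_finite_image himg ?_
  intro P _ Q _ hPQ
  have hne : ∀ R : Projectivization K (Fin (k + 1) → K), upoly k R.rep ≠ 0 := by
    intro R h0
    apply R.rep_nonzero
    funext i
    rw [← hcoeff R.rep i, h0]
    simp
  have hP := (IsAlgClosed.splits (upoly k P.rep)).eq_prod_roots
  have hQ := (IsAlgClosed.splits (upoly k Q.rep)).eq_prod_roots
  have hPQ' : (upoly k P.rep).roots = (upoly k Q.rep).roots := hPQ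
  have hlq : (upoly k Q.rep).leadingCoeff ≠ 0 := Polynomial.leadingCoeff_ne_zero.mpr (hne Q)
  have key : upoly k P.rep = Polynomial.C ((upoly k P.rep).leadingCoeff /
      (upoly k Q.rep).leadingCoeff) * upoly k Q.rep := by
    rw [hPQ'] at hP
    have hC : Polynomial.C (upoly k P.rep).leadingCoeff =
        Polynomial.C ((upoly k P.rep).leadingCoeff / (upoly k Q.rep).leadingCoeff) *
          Polynomial.C (upoly k Q.rep).leadingCoeff := by
      rw [← Polynomial.C_mul, div_mul_cancel₀ _ hlq]
    refine hP.trans ?_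
    rw [hC, mul_assoc]
    exact congrArg _ hQ.symm
  rw [← P.mk_rep, ← Q.mk_rep, Projectivization.mk_eq_mk_iff']
  refine ⟨(upoly k P.rep).leadingCoeff / (upoly k Q.rep).leadingCoeff, ?_⟩
  funext i
  have := congrArg (fun p => Polynomial.coeff p (i : ℕ)) key
  simp only [Polynomial.coeff_C_mul, hcoeff] at this
  exact this.symm

end
end

section
/- Let 2 ≤ k ≤ n−1 and let G = x_0 s^k + x_1 s^{k−1}t + ⋯ + x_k t^k be a nonzero binary form of degree k. Then all (n−k+3)×(n−k+3) minors of M_k vanish at the coefficient vector (x_0,…,x_k) (i.e., [G] ∈ X_k(K)) if and only if there exists a point P = (p_0:p_1:p_2) ∈ ℙ²(K) such that G divides p_i f_j − p_j f_i in K[s,t] for all 0 ≤ i < j ≤ 2. -/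
open MvPolynomial

noncomputable section

section Helpers
variable {K : Type*} [Field K]

/-- `formOf` as a linear map. -/
def formLin (k : ℕ) : (Fin (k + 1) → K) →ₗ[K] MvPolynomial (Fin 2) K where
  toFun := formOf k
  map_add' x y := by
    simp only [formOf, Pi.add_apply, C_add, add_mul, Finset.sum_add_distrib]
  map_smul' a x := by
    simp only [formOf, Pi.smul_apply, smul_eq_mul, C_mul, RingHom.id_apply, Finset.smul_sum,
      MvPolynomial.smul_eq_C_mul, mul_assoc]

theorem formLin_apply (k : ℕ) (x : Fin (k + 1) → K) : formLin k x = formOf k x := rfl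

theorem formOf_eq_monomial (k : ℕ) (x : Fin (k + 1) → K) :
    formOf k x = ∑ i : Fin (k + 1),
      monomial (Finsupp.single 0 (k - (i : ℕ)) + Finsupp.single 1 (i : ℕ)) (x i) := by
  unfold formOf
  refine Finset.sum_congr rfl fun i _ => ?_
  rw [X_pow_eq_monomial, X_pow_eq_monomial, C_mul_monomial, monomial_mul]
  simp

theorem formOf_homog (k : ℕ) (x : Fin (k + 1) → K) : (formOf k x).IsHomogeneous k := by
  rw [formOf_eq_monomial]
  refine IsHomogeneous.sum _ _ _ fun i _ => isHomogeneous_monomial _ ?_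
  rw [map_add, Finsupp.degree_single, Finsupp.degree_single]
  have := i.isLt
  omega

theorem bcoeff_formOf (k : ℕ) (x : Fin (k + 1) → K) (i : Fin (k + 1)) :
    bcoeff k (formOf k x) i = x i := by
  rw [bcoeff, formOf_eq_monomial, coeff_sum, Finset.sum_eq_single i]
  · simp
  · intro b _ hb
    rw [coeff_monomial, if_neg]
    intro h
    have := DFunLike.congr_fun h 1
    simp at this
    exact hb (Fin.ext this)
  · simp

theorem formLin_inj (k : ℕ) : Function.Injective (formLin (K := K) k) := by
  intro x y h
  funext i
  rw [← bcoeff_formOf k x i, ← bcoeff_formOf k y i]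
  exact congrArg (fun p => bcoeff k p i) h

theorem formOf_bcoeff (n : ℕ) (h : MvPolynomial (Fin 2) K) (hh : h.IsHomogeneous n) :
    formOf n (bcoeff n h) = h := by
  ext d
  by_cases hd : d.degree = n
  · have hd2 : d 0 + d 1 = n := by
      rw [← hd, Finsupp.degree_eq_sum, Fin.sum_univ_two]
    have key : d = Finsupp.single 0 (n - d 1) + Finsupp.single 1 (d 1) := by
      ext i
      fin_cases i
      · simp; omega
      · simp
    have h1 := bcoeff_formOf n (bcoeff n h) ⟨d 1, by omega⟩
    simp only [bcoeff] at h1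
    rw [← key] at h1
    exact h1
  · rw [(formOf_homog n _).coeff_eq_zero hd, hh.coeff_eq_zero hd]

/-- Row of the staircase part, evaluated. -/
def stair (n k : ℕ) (x : Fin (k + 1) → K) (j : Fin (n - k + 1)) (c : Fin (n + 1)) : K :=
  if h : (j : ℕ) ≤ (c : ℕ) ∧ (c : ℕ) ≤ (j : ℕ) + k then
    x ⟨(c : ℕ) - (j : ℕ), by omega⟩ else 0

theorem formOf_stair (n k : ℕ) (hk : k ≤ n) (x : Fin (k + 1) → K) (j : Fin (n - k + 1)) :
    formOf n (stair n k x j) = formOf k x * (X 0 ^ (n - k - (j : ℕ)) * X 1 ^ (j : ℕ)) := by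
  have hj := j.isLt
  symm
  unfold formOf
  rw [Finset.sum_mul]
  refine Finset.sum_of_injOn (fun i : Fin (k + 1) => (⟨i + j, by omega⟩ : Fin (n + 1)))
    ?_ ?_ ?_ ?_
  · intro a _ b _ hab
    simp at hab
    exact Fin.ext hab
  · intro a _; simp
  · intro c _ hc
    rw [stair, dif_neg]
    · simp
    · intro h
      apply hc
      refine ⟨⟨(c : ℕ) - j, by omega⟩, by simp, ?_⟩
      apply Fin.ext
      simp; omega
  · intro i _
    have hi := i.isLt
    rw [stair, dif_pos (by simp; omega)]
    simp only [Nat.add_sub_cancel]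
    have : n - ((i : ℕ) + j) = (k - i) + (n - k - j) := by omega
    rw [this, pow_add, pow_add]
    ring

theorem formOf_stair_sum (n k : ℕ) (hk : k ≤ n) (x : Fin (k + 1) → K)
    (y : Fin (n - k + 1) → K) :
    formOf n (∑ j, y j • stair n k x j) = formOf k x * formOf (n - k) y := by
  rw [← formLin_apply, map_sum]
  simp only [map_smul, formLin_apply, formOf_stair n k hk]
  rw [show formOf (n - k) y = ∑ i : Fin (n - k + 1), C (y i) * X 0 ^ (n - k - (i : ℕ)) *
    X 1 ^ (i : ℕ) from rfl, Finset.mul_sum]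
  refine Finset.sum_congr rfl fun j _ => ?_
  rw [MvPolynomial.smul_eq_C_mul]
  ring

theorem exists_homog_quot {σ : Type*} {n k : ℕ} (hk : k ≤ n) {G H Q : MvPolynomial σ K}
    (hG : G.IsHomogeneous k) (hH : H.IsHomogeneous n) (h : H = G * Q) :
    ∃ Q', Q'.IsHomogeneous (n - k) ∧ H = G * Q' := by
  letI : GradedAlgebra (homogeneousSubmodule σ K) := MvPolynomial.gradedAlgebra
  have h1 := DirectSum.coe_decompose_mul_of_left_mem_of_le
    (homogeneousSubmodule σ K) (a := G) (b := Q) (i := k) (n := n) hG hk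
  rw [← h, DirectSum.decompose_of_mem_same (homogeneousSubmodule σ K) (x := H) hH] at h1
  exact ⟨_, (DirectSum.decompose (homogeneousSubmodule σ K) Q (n - k)).2, h1⟩

theorem dvd_iff_mem (n k : ℕ) (hk : k ≤ n) (x : Fin (k + 1) → K)
    (y : Fin (n + 1) → K) :
    formOf k x ∣ formOf n y ↔ y ∈ Submodule.span K (Set.range (stair n k x)) := by
  rw [Submodule.mem_span_range_iff_exists_fun]
  constructor
  · rintro ⟨Q, hQ⟩
    obtain ⟨Q', hQ', h⟩ := exists_homog_quot hk (formOf_homog k x) (formOf_homog n y) hQ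
    refine ⟨bcoeff (n - k) Q', ?_⟩
    apply formLin_inj n
    rw [formLin_apply, formLin_apply, formOf_stair_sum n k hk, formOf_bcoeff _ _ hQ', h]
  · rintro ⟨c, rfl⟩
    rw [formOf_stair_sum n k hk]
    exact dvd_mul_right _ _

theorem stair_li (n k : ℕ) (hk : k ≤ n) (x : Fin (k + 1) → K) (hx : x ≠ 0) :
    LinearIndependent K (stair n k x) := by
  rw [Fintype.linearIndependent_iff]
  intro g hg
  have h := formOf_stair_sum n k hk x g
  rw [hg, ← formLin_apply, map_zero] at h
  have hG : formOf k x ≠ 0 := by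
    intro h0
    apply hx
    apply formLin_inj k
    rw [map_zero, formLin_apply, h0]
  have h2 : formOf (n - k) g = 0 := by
    rcases mul_eq_zero.1 h.symm with h | h
    · exact absurd h hG
    · exact h
  have : g = 0 := by
    apply formLin_inj (n - k)
    rw [map_zero, formLin_apply, h2]
  intro i; rw [this]; rfl

theorem exists_li_subfamily {V : Type*} [AddCommGroup V] [Module K V] {ι : Type*} [Finite ι]
    (v : ι → V) (d : ℕ) (hd : d ≤ Module.finrank K (Submodule.span K (Set.range v))) :
    ∃ c : Fin d → ι, Function.Injective c ∧ LinearIndependent K (v ∘ c) := by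
  obtain ⟨κ, a, ha, hsp, hli⟩ := exists_linearIndependent' K v
  have : Finite κ := Finite.of_injective a ha
  have := Fintype.ofFinite κ
  have hc := finrank_span_eq_card hli
  rw [hsp] at hc
  rw [hc] at hd
  let e := (Fintype.equivFin κ).symm
  refine ⟨fun i => a (e (Fin.castLE hd i)), ?_, ?_⟩
  · exact ha.comp (e.injective.comp (Fin.castLE_injective hd))
  · exact hli.comp (fun i => e (Fin.castLE hd i))
      (e.injective.comp (Fin.castLE_injective hd))

theorem minors_iff {p q d : ℕ} (N : Matrix (Fin p) (Fin q) K) :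
    (∀ (r : Fin d → Fin p) (c : Fin d → Fin q), Function.Injective r → Function.Injective c →
      (N.submatrix r c).det = 0) ↔
    Module.finrank K (Submodule.span K (Set.range N.row)) < d := by
  constructor
  · intro h
    by_contra! hlt
    obtain ⟨r, hr, hrl⟩ := exists_li_subfamily N.row d hlt
    have h1 : (N.submatrix r id).rank = d := by
      have : LinearIndependent K (N.submatrix r id).row := hrl
      simpa using this.rank_matrix
    rw [Matrix.rank_eq_finrank_span_cols] at h1
    obtain ⟨c, hc, hcl⟩ := exists_li_subfamily (N.submatrix r id).col d h1.ge
    have h2 : LinearIndependent K (N.submatrix r c).col := hcl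
    rw [Matrix.linearIndependent_cols_iff_isUnit, Matrix.isUnit_iff_isUnit_det] at h2
    exact h2.ne_zero (h r c hr hc)
  · intro h r c hr hc
    by_contra hne
    have h2 : IsUnit (N.submatrix r c) := by
      rw [Matrix.isUnit_iff_isUnit_det]; exact isUnit_iff_ne_zero.2 hne
    rw [← Matrix.linearIndependent_rows_iff_isUnit] at h2
    have h3 : LinearIndependent K (N.row ∘ r) :=
      LinearIndependent.of_comp (LinearMap.funLeft K K c) h2
    have h4 := finrank_span_eq_card h3
    have h5 : Submodule.span K (Set.range (N.row ∘ r)) ≤ Submodule.span K (Set.range N.row) :=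
      Submodule.span_mono (Set.range_comp_subset_range _ _)
    have h6 := Submodule.finrank_mono h5
    rw [h4, Fintype.card_fin] at h6
    omega

theorem rank_iff {V : Type*} [AddCommGroup V] [Module K V] [FiniteDimensional K V]
    (W : Submodule K V) (v : Fin 3 → V) :
    Module.finrank K (W ⊔ Submodule.span K (Set.range v) : Submodule K V)
      < Module.finrank K W + 2 ↔
    ∃ p : Fin 3 → K, p ≠ 0 ∧ ∀ i j, i < j → p i • v j - p j • v i ∈ W := by
  constructor
  · intro h
    by_cases hall : ∀ a, v a ∈ W
    · refine ⟨fun _ => 1, fun hc => one_ne_zero (congrFun hc 0), fun i j _ => ?_⟩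
      exact W.sub_mem (W.smul_mem _ (hall _)) (W.smul_mem _ (hall _))
    · push Not at hall
      obtain ⟨a, ha⟩ := hall
      have hlt : W < W ⊔ Submodule.span K {v a} := by
        refine lt_of_le_of_ne le_sup_left fun he => ha ?_
        rw [he]
        exact Submodule.mem_sup_right (Submodule.mem_span_singleton_self _)
      have h1 := Submodule.finrank_lt_finrank_of_lt hlt
      have hle : W ⊔ Submodule.span K {v a} ≤ W ⊔ Submodule.span K (Set.range v) :=
        sup_le_sup_left (Submodule.span_mono (by simp)) _
      have heq := Submodule.eq_of_le_of_finrank_le hle (by omega)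
      have hm : ∀ u, ∃ c : K, v u - c • v a ∈ W := by
        intro u
        have : v u ∈ W ⊔ Submodule.span K {v a} := by
          rw [heq]
          exact Submodule.mem_sup_right (Submodule.subset_span ⟨u, rfl⟩)
        obtain ⟨w, hw, z, hz, hwz⟩ := Submodule.mem_sup.1 this
        obtain ⟨c, rfl⟩ := Submodule.mem_span_singleton.1 hz
        exact ⟨c, by rw [← hwz]; simpa using hw⟩
      choose c hc using hm
      refine ⟨c, ?_, fun i j _ => ?_⟩
      · intro h0
        apply ha
        have := hc a
        simpa [h0] using this
      · have : c i • v j - c j • v i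
            = c i • (v j - c j • v a) - c j • (v i - c i • v a) := by
          module
        rw [this]
        exact W.sub_mem (W.smul_mem _ (hc _)) (W.smul_mem _ (hc _))
  · rintro ⟨p, hp, h⟩
    have h' : ∀ i j, p i • v j - p j • v i ∈ W := by
      intro i j
      rcases lt_trichotomy i j with hij | rfl | hij
      · exact h i j hij
      · simp
      · rw [← neg_sub]; exact W.neg_mem (h j i hij)
    obtain ⟨a, ha⟩ := Function.ne_iff.1 hp
    have ha : p a ≠ 0 := ha
    have hle : W ⊔ Submodule.span K (Set.range v) ≤ W ⊔ Submodule.span K {v a} := by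
      refine sup_le le_sup_left (Submodule.span_le.2 ?_)
      rintro _ ⟨u, rfl⟩
      have : v u = (p a)⁻¹ • (p a • v u - p u • v a) + ((p a)⁻¹ * p u) • v a := by
        rw [smul_sub, smul_smul, smul_smul, inv_mul_cancel₀ ha]; simp
      rw [this]
      exact Submodule.add_mem _ (Submodule.mem_sup_left (W.smul_mem _ (h' a u)))
        (Submodule.mem_sup_right (Submodule.smul_mem _ _ (Submodule.mem_span_singleton_self _)))
    have h1 := Submodule.finrank_mono hle
    have h2 := Submodule.finrank_add_le_finrank_add_finrank W (Submodule.span K {v a})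
    have h3 := finrank_span_le_card (R := K) ({v a} : Set V)
    simp at h3
    omega

end Helpers

/-- A nonzero binary form `G` of degree `k` lies in `X_k(K)` (all `(n-k+3)`-minors of `M_k`
vanish at its coefficient vector) if and only if there is a point `P = (p_0:p_1:p_2) ∈ ℙ²(K)`
such that `G` divides `p_i f_j - p_j f_i` for all `0 ≤ i < j ≤ 2`. -/
theorem statement_2 {K : Type*} [Field K] [IsAlgClosed K] [CharZero K]
    (n : ℕ) (hn : 3 ≤ n) (f : Fin 3 → MvPolynomial (Fin 2) K)
    (hf : IsProperParam n f)
    (k : ℕ) (hk2 : 2 ≤ k) (hkn : k ≤ n - 1)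
    (x : Fin (k + 1) → K) (hx : x ≠ 0) :
    (∀ g ∈ minorsSet n k f, MvPolynomial.eval x g = 0) ↔
      ∃ p : Fin 3 → K, p ≠ 0 ∧
        ∀ i j : Fin 3, i < j → formOf k x ∣ crossDiff f p i j := by
  have hk : k ≤ n := by omega
  set N : Matrix (Fin (n - k + 4)) (Fin (n + 1)) K := (Mmat n k f).map (MvPolynomial.eval x)
    with hN
  have hA : (∀ g ∈ minorsSet n k f, MvPolynomial.eval x g = 0) ↔
      (∀ (r : Fin (n - k + 3) → Fin (n - k + 4)) (c : Fin (n - k + 3) → Fin (n + 1)),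
        Function.Injective r → Function.Injective c → (N.submatrix r c).det = 0) := by
    have hdet : ∀ (r : Fin (n - k + 3) → Fin (n - k + 4)) (c : Fin (n - k + 3) → Fin (n + 1)),
        MvPolynomial.eval x ((Mmat n k f).submatrix r c).det = (N.submatrix r c).det := by
      intro r c
      rw [RingHom.map_det]
      rfl
    constructor
    · intro h r c hr hc
      rw [← hdet]
      exact h _ ⟨r, c, hr, hc, rfl⟩
    · rintro h _ ⟨r, c, hr, hc, rfl⟩
      rw [hdet]
      exact h r c hr hc
  have hrow1 : ∀ j : Fin (n - k + 1), N.row ⟨j, by omega⟩ = stair n k x j := by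
    intro j
    have hj := j.isLt
    funext c
    simp only [hN, Matrix.row, Matrix.map_apply, Mmat, stair]
    rw [dif_pos (by omega)]
    split_ifs <;> simp
  have hrow2 : ∀ u : Fin 3, N.row ⟨n - k + 1 + u, by omega⟩ = bcoeff n (f u) := by
    intro u
    funext c
    simp only [hN, Matrix.row, Matrix.map_apply, Mmat]
    rw [dif_neg (by omega)]
    simp
  have hspan : Submodule.span K (Set.range N.row) =
      Submodule.span K (Set.range (stair n k x)) ⊔
        Submodule.span K (Set.range fun u => bcoeff n (f u)) := by
    rw [← Submodule.span_union]
    congr 1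
    ext y
    constructor
    · rintro ⟨j, rfl⟩
      have hjlt := j.isLt
      by_cases hj : (j : ℕ) < n - k + 1
      · left
        exact ⟨⟨j, hj⟩, (hrow1 ⟨j, hj⟩).symm⟩
      · right
        refine ⟨⟨j - (n - k + 1), by omega⟩, ?_⟩
        change bcoeff n (f ⟨j - (n - k + 1), by omega⟩) = _
        rw [← hrow2]
        congr 1
        apply Fin.ext
        simp
        omega
    · rintro (⟨j, rfl⟩ | ⟨u, rfl⟩)
      · exact ⟨_, hrow1 j⟩
      · exact ⟨_, hrow2 u⟩
  have hW : Module.finrank K (Submodule.span K (Set.range (stair n k x))) = n - k + 1 := by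
    rw [finrank_span_eq_card (stair_li n k hk x hx), Fintype.card_fin]
  rw [hA, minors_iff, hspan, show n - k + 3 = Module.finrank K
    (Submodule.span K (Set.range (stair n k x))) + 2 by rw [hW], rank_iff]
  refine exists_congr fun p => and_congr_right fun _ => forall_congr' fun i =>
    forall_congr' fun j => imp_congr_right fun _ => ?_
  rw [← dvd_iff_mem n k hk, ← formLin_apply n, map_sub, map_smul, map_smul, formLin_apply,
    formLin_apply, formOf_bcoeff _ _ (hf.homog _), formOf_bcoeff _ _ (hf.homog _), crossDiff,
    MvPolynomial.smul_eq_C_mul, MvPolynomial.smul_eq_C_mul]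

end
end

section
/- For every point P ∈ ℙ²(K), the multiplicity m_P(C) of the curve C at P equals the degree of the binary form G_P, the greatest common divisor of the three cross differences p_i f_j − p_j f_i (0 ≤ i < j ≤ 2). In particular m_P(C) = 0 exactly when G_P is constant, and P is a singular point of C exactly when deg G_P ≥ 2. -/
open MvPolynomial

noncomputable section

theorem aux_sub_mem {σ K : Type*} [Field K] (I : Ideal (MvPolynomial σ K))
    (g : σ → MvPolynomial σ K) (h : ∀ i, X i - g i ∈ I) (q : MvPolynomial σ K) :
    q - aeval g q ∈ I := by
  rw [← Ideal.Quotient.mk_eq_mk_iff_sub_mem]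
  have : (Ideal.Quotient.mkₐ K I) = (Ideal.Quotient.mkₐ K I).comp (aeval g) := by
    apply MvPolynomial.algHom_ext
    intro i
    simp only [AlgHom.comp_apply, aeval_X]
    exact (Ideal.Quotient.mk_eq_mk_iff_sub_mem _ _).2 (h i)
  exact congrArg (fun φ : MvPolynomial σ K →ₐ[K] _ => φ q) this

/-- The grading substitution `X_i ↦ X_i T`. -/
def gradSub {σ K : Type*} [Field K] : MvPolynomial σ K →ₐ[K] Polynomial (MvPolynomial σ K) :=
  aeval (fun i => Polynomial.C (X i) * Polynomial.X)

theorem gradSub_monomial {σ K : Type*} [Field K] (e : σ →₀ ℕ) (c : K) :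
    gradSub (monomial e c) = Polynomial.monomial e.degree (monomial e c) := by
  rw [gradSub, aeval_monomial]
  simp only [mul_pow, Finsupp.prod, Finset.prod_mul_distrib]
  rw [Finset.prod_pow_eq_pow_sum, ← Polynomial.C_mul_X_pow_eq_monomial, monomial_eq]
  simp only [Finsupp.prod, map_mul, map_prod, map_pow]
  rw [← mul_assoc]
  rfl

theorem gradSub_coeff {σ K : Type*} [Field K] (q : MvPolynomial σ K) (k : ℕ) :
    (gradSub q).coeff k = homogeneousComponent k q := by
  induction q using MvPolynomial.induction_on' with
  | monomial e c =>
    rw [gradSub_monomial, Polynomial.coeff_monomial]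
    split_ifs with h
    · exact (homogeneousComponent_eq_self (isHomogeneous_monomial c h)).symm
    · rw [homogeneousComponent_of_mem (isHomogeneous_monomial c rfl), if_neg]
      exact fun h' => h h'.symm
  | add p q hp hq => simp [hp, hq]

theorem homog_of_mul {σ K : Type*} [Field K] {a b : MvPolynomial σ K} {n : ℕ}
    (h : (a * b).IsHomogeneous n) (h0 : a * b ≠ 0) :
    ∃ d, a.IsHomogeneous d := by
  have hinj : ∀ q : MvPolynomial σ K, gradSub q = 0 → q = 0 := by
    intro q hq
    rw [← sum_homogeneousComponent q]
    refine Finset.sum_eq_zero fun i _ => ?_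
    rw [← gradSub_coeff, hq, Polynomial.coeff_zero]
  have ha : gradSub a ≠ 0 := fun h => h0 (by rw [hinj a h, zero_mul])
  have hb : gradSub b ≠ 0 := fun h => h0 (by rw [hinj b h, mul_zero])
  have hm : gradSub a * gradSub b = Polynomial.monomial n (a * b) := by
    rw [← map_mul]
    ext1 k
    rw [gradSub_coeff, Polynomial.coeff_monomial, homogeneousComponent_of_mem h]
    simp only [eq_comm]
  have h1 := Polynomial.natDegree_mul ha hb
  have h2 := Polynomial.natTrailingDegree_mul ha hb
  rw [hm, Polynomial.natDegree_monomial_eq _ h0] at h1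
  rw [hm, Polynomial.natTrailingDegree_monomial h0] at h2
  have h3 := Polynomial.natTrailingDegree_le_natDegree (gradSub a)
  have h4 := Polynomial.natTrailingDegree_le_natDegree (gradSub b)
  have h5 : (gradSub a).natTrailingDegree = (gradSub a).natDegree := by omega
  refine ⟨(gradSub a).natDegree, ?_⟩
  have : a = homogeneousComponent (gradSub a).natDegree a := by
    conv_lhs => rw [← sum_homogeneousComponent a]
    by_contra hne
    apply hne
    refine Finset.sum_eq_single _ ?_ ?_
    · intro k _ hk
      rw [← gradSub_coeff]
      rcases lt_or_gt_of_ne hk with h | h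
      · exact Polynomial.coeff_eq_zero_of_lt_natTrailingDegree (by omega)
      · exact Polynomial.coeff_eq_zero_of_natDegree_lt h
    · intro hk
      apply homogeneousComponent_eq_zero
      simpa using hk
  have h6 := homogeneousComponent_isHomogeneous (gradSub a).natDegree a
  rwa [← this] at h6

theorem eval_smul_homog {σ K : Type*} [Field K] {h : MvPolynomial σ K} {d : ℕ}
    (hh : h.IsHomogeneous d) (c : K) (v : σ → K) :
    eval (fun i => c * v i) h = c ^ d * eval v h := by
  rw [eval_eq, eval_eq, Finset.mul_sum]
  refine Finset.sum_congr rfl fun e he => ?_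
  have : e.degree = d := by
    by_contra hne
    exact (mem_support_iff.1 he) (hh.coeff_eq_zero hne)
  simp only [mul_pow, Finset.prod_mul_distrib, Finset.prod_pow_eq_pow_sum]
  rw [← this, Finsupp.degree_apply]
  ring

/-- Dehomogenization `s = 1`. -/
def deh {K : Type*} [Field K] : MvPolynomial (Fin 2) K →ₐ[K] Polynomial K :=
  aeval ![1, Polynomial.X]

theorem deh_eval {K : Type*} [Field K] (h : MvPolynomial (Fin 2) K) (t : K) :
    (deh h).eval t = eval ![1, t] h := by
  induction h using MvPolynomial.induction_on with
  | C a => simp [deh]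
  | add p q hp hq => simp [hp, hq]
  | mul_X p i hp =>
    rw [map_mul, Polynomial.eval_mul, hp, eval_mul]
    fin_cases i <;> simp [deh]

theorem deh_monomial {K : Type*} [Field K] (e : Fin 2 →₀ ℕ) (c : K) :
    deh (monomial e c) = Polynomial.monomial (e 1) c := by
  rw [deh, aeval_monomial, Finsupp.prod_fintype _ _ (by simp)]
  simp [← Polynomial.C_mul_X_pow_eq_monomial]

theorem deh_eq_sum {K : Type*} [Field K] (h : MvPolynomial (Fin 2) K) :
    deh h = ∑ e ∈ h.support, Polynomial.monomial (e 1) (coeff e h) := by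
  conv_lhs => rw [h.as_sum]
  rw [map_sum]
  simp only [deh_monomial]

theorem deh_natDegree_le {K : Type*} [Field K] {h : MvPolynomial (Fin 2) K} {d : ℕ}
    (hh : h.IsHomogeneous d) : (deh h).natDegree ≤ d := by
  rw [deh_eq_sum]
  refine Polynomial.natDegree_sum_le_of_forall_le _ _ fun e he => ?_
  refine (Polynomial.natDegree_monomial_le _).trans ?_
  have := hh.degree_eq_sum_deg_support he
  rw [← Finsupp.degree_apply] at this
  rw [this]
  exact Finsupp.le_degree 1 e

theorem deh_coeff_top {K : Type*} [Field K] {h : MvPolynomial (Fin 2) K} {d : ℕ}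
    (hh : h.IsHomogeneous d) : (deh h).coeff d = eval ![0, 1] h := by
  rw [deh_eq_sum, Polynomial.finsetSum_coeff, eval_eq]
  refine Finset.sum_congr rfl fun e he => ?_
  have h1 := hh.degree_eq_sum_deg_support he
  rw [← Finsupp.degree_apply, Finsupp.degree_eq_sum, Fin.sum_univ_two] at h1
  rw [Polynomial.coeff_monomial, Finset.prod_subset (Finset.subset_univ _)
    (by intro i _ hi; simp [Finsupp.notMem_support_iff.1 hi]), Fin.prod_univ_two]
  by_cases h0 : e 0 = 0
  · have : e 1 = d := by omega
    simp [h0, this]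
  · have : e 1 ≠ d := by omega
    simp [h0, this]

theorem deh_inj {K : Type*} [Field K] [Infinite K] {h : MvPolynomial (Fin 2) K} {d : ℕ}
    (hh : h.IsHomogeneous d) (h0 : deh h = 0) : h = 0 := by
  have key : h * X 0 = 0 := by
    apply MvPolynomial.funext
    intro v
    by_cases hv : v 0 = 0
    · simp [hv]
    · have e1 : v = fun i => v 0 * (![1, v 1 / v 0] : Fin 2 → K) i := by
        ext i; fin_cases i <;> simp [mul_div_cancel₀, hv]
      have : eval v h = 0 := by
        rw [e1, eval_smul_homog hh, ← deh_eval, h0]; simp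
      simp [this]
  rcases mul_eq_zero.1 key with h | h
  · exact h
  · exact absurd h (X_ne_zero _)

theorem gauss_aux {R k L : Type*} [CommRing R] [IsDomain R] [UniqueFactorizationMonoid R]
    [Field k] [Algebra R k] [IsFractionRing R k] [Field L] [Algebra k L]
    (F H : Polynomial R) (hF : Irreducible F) (y : L) (hd : F.natDegree ≠ 0)
    (hFy : Polynomial.aeval y (F.map (algebraMap R k)) = 0) (hH : H ≠ 0)
    (hHy : Polynomial.aeval y (H.map (algebraMap R k)) = 0) :
    F.natDegree ≤ H.natDegree := by
  classical
  let _ : NormalizedGCDMonoid R := Classical.choice inferInstance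
  have hirr := ((hF.isPrimitive hd).irreducible_iff_irreducible_map_fraction_map
    (K := k)).1 hF
  have hinj := IsFractionRing.injective R k
  have hH' : H.map (algebraMap R k) ≠ 0 := (Polynomial.map_ne_zero_iff hinj).2 hH
  have e1 := Polynomial.degree_le_of_dvd ((minpoly.dvd_iff (A := k) (x := y)).2 hHy) hH'
  have e2 := (minpoly.dvd_iff (A := k) (x := y)).2 hFy
  have hInt : IsIntegral k y := ⟨_, Polynomial.monic_mul_leadingCoeff_inv hirr.ne_zero, by
    rw [← Polynomial.aeval_def, map_mul, hFy, zero_mul]⟩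
  have e3 := (minpoly.irreducible hInt).associated_of_dvd hirr e2
  have e4 := Polynomial.degree_eq_degree_of_associated e3
  rw [e4, Polynomial.degree_map_eq_of_injective hinj,
    Polynomial.degree_map_eq_of_injective hinj] at e1
  exact Polynomial.natDegree_le_natDegree e1

theorem gauss_deg0 {R T k L : Type*} [CommRing R] [IsDomain R] [UniqueFactorizationMonoid R]
    [CommRing T] [Field k] [Algebra R k] [IsFractionRing R k] [Field L] [Algebra T L]
    (hTL : Function.Injective (algebraMap T L))
    (ψ : R →+* T) (hψ : Function.Injective ψ) (F H : Polynomial R) (hF : Irreducible F) (y : T)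
    (hFy : F.eval₂ ψ y = 0) (hH : H ≠ 0) (hHy : H.eval₂ ψ y = 0) :
    F.natDegree ≤ H.natDegree := by
  by_cases hd : F.natDegree = 0
  · omega
  have hφ : Function.Injective ((algebraMap T L).comp ψ) := hTL.comp hψ
  let χ : k →+* L := IsFractionRing.lift hφ
  have hχ : χ.comp (algebraMap R k) = (algebraMap T L).comp ψ := by
    apply RingHom.ext
    intro r
    exact IsFractionRing.lift_algebraMap hφ r
  have hev : ∀ P : Polynomial R, P.eval₂ ψ y = 0 →
      (P.map (algebraMap R k)).eval₂ χ (algebraMap T L y) = 0 := by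
    intro P hP
    rw [Polynomial.eval₂_map, hχ, ← Polynomial.hom_eval₂, hP, map_zero]
  clear_value χ
  let _ : Algebra k L := χ.toAlgebra
  exact gauss_aux (k := k) F H hF (algebraMap T L y) hd (hev F hFy) hH (hev H hHy)

theorem gauss_deg {R T : Type*} [CommRing R] [IsDomain R] [UniqueFactorizationMonoid R]
    [CommRing T] [IsDomain T]
    (ψ : R →+* T) (hψ : Function.Injective ψ) (F H : Polynomial R) (hF : Irreducible F) (y : T)
    (hFy : F.eval₂ ψ y = 0) (hH : H ≠ 0) (hHy : H.eval₂ ψ y = 0) :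
    F.natDegree ≤ H.natDegree :=
  gauss_deg0 (k := FractionRing R) (L := FractionRing T)
    (IsFractionRing.injective T (FractionRing T)) ψ hψ F H hF y hFy hH hHy

theorem eval_aeval' {σ τ K : Type*} [Field K] (u : τ → K) (g : σ → MvPolynomial τ K)
    (h : MvPolynomial σ K) : eval u (aeval g h) = eval (fun i => eval u (g i)) h := by
  induction h using MvPolynomial.induction_on with
  | C a => simp [algebraMap_eq]
  | add p q hp hq => rw [map_add, map_add, map_add, hp, hq]
  | mul_X p i hp => rw [map_mul, map_mul, map_mul, hp, aeval_X, eval_X]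

theorem lin_dvd {K : Type*} [Field K] [Infinite K] {h : MvPolynomial (Fin 2) K} {d : ℕ}
    (hh : h.IsHomogeneous d) (v : Fin 2 → K) (hv : v ≠ 0) (h0 : eval v h = 0) :
    (C (v 1) * X 0 - C (v 0) * X 1) ∣ h := by
  obtain ⟨j, hj⟩ : ∃ j, v j ≠ 0 := by
    by_contra hc
    push Not at hc
    exact hv (_root_.funext hc)
  rw [← Ideal.mem_span_singleton]
  have key := aux_sub_mem (Ideal.span {(C (v 1) * X 0 - C (v 0) * X 1 : MvPolynomial (Fin 2) K)})
    (fun i => C (v i / v j) * X j) ?_ h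
  · have hz : aeval (fun i => (C (v i / v j) * X j : MvPolynomial (Fin 2) K)) h = 0 := by
      apply MvPolynomial.funext
      intro u
      have e1 : eval u (aeval (fun i => (C (v i / v j) * X j : MvPolynomial (Fin 2) K)) h)
          = eval (fun i => (u j / v j) * v i) h := by
        rw [eval_aeval']
        congr 2
        ext i
        simp
        ring
      rw [e1, eval_smul_homog hh, h0]
      simp
    rwa [hz, sub_zero] at key
  · intro i
    rw [Ideal.mem_span_singleton]
    fin_cases j <;> fin_cases i <;> simp only [Fin.zero_eta, Fin.mk_one, Fin.isValue] at hj ⊢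
    · rw [div_self hj]; simp
    · refine ⟨- C (1 / v 0), ?_⟩
      have : (C (v 0) * C (1 / v 0) : MvPolynomial (Fin 2) K) = 1 := by
        rw [← C_mul, mul_one_div_cancel hj, C_1]
      have h2 : (C (v 1 / v 0) : MvPolynomial (Fin 2) K) = C (v 1) * C (1 / v 0) := by
        rw [← C_mul, mul_one_div]
      rw [h2]
      linear_combination (- X 1 : MvPolynomial (Fin 2) K) * this
    · refine ⟨C (1 / v 1), ?_⟩
      have : (C (v 1) * C (1 / v 1) : MvPolynomial (Fin 2) K) = 1 := by
        rw [← C_mul, mul_one_div_cancel hj, C_1]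
      have h2 : (C (v 0 / v 1) : MvPolynomial (Fin 2) K) = C (v 0) * C (1 / v 1) := by
        rw [← C_mul, mul_one_div]
      rw [h2]
      linear_combination (- X 0 : MvPolynomial (Fin 2) K) * this
    · rw [div_self hj]; simp

theorem no_common {K : Type*} [Field K] [Infinite K] {a b : MvPolynomial (Fin 2) K} {d : ℕ}
    (ha : a.IsHomogeneous d) (hb : b.IsHomogeneous d)
    (hab : ∀ D, D ∣ a → D ∣ b → IsUnit D) (v : Fin 2 → K) (hv : v ≠ 0)
    (h1 : eval v a = 0) (h2 : eval v b = 0) : False := by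
  have := (hab _ (lin_dvd ha v hv h1) (lin_dvd hb v hv h2)).map (eval v)
  apply this.ne_zero
  simp [mul_comm]

theorem good_c {K : Type*} [Field K] [IsAlgClosed K] [CharZero K]
    {a b : MvPolynomial (Fin 2) K} {D : ℕ} (hD : 0 < D)
    (ha : a.IsHomogeneous D) (hb : b.IsHomogeneous D)
    (hab : ∀ v : Fin 2 → K, v ≠ 0 → eval v a = 0 → eval v b = 0 → False) (S : Finset K) :
    ∃ B : Finset K, ∀ c, c ∉ B → ∃ T : Finset K, T.card = D ∧
      ∀ t ∈ T, (deh a).eval t = c * (deh b).eval t ∧ (deh b).eval t ≠ 0 ∧ t ∉ S := by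
  classical
  have hne : ∀ t, (deh a).eval t = 0 → (deh b).eval t = 0 → False := by
    intro t h1 h2
    rw [deh_eval] at h1 h2
    exact hab ![1, t] (fun h => one_ne_zero (congrFun h 0)) h1 h2
  have hinf : ¬ ((deh a).coeff D = 0 ∧ (deh b).coeff D = 0) := by
    rintro ⟨h1, h2⟩
    rw [deh_coeff_top ha] at h1
    rw [deh_coeff_top hb] at h2
    exact hab ![0, 1] (fun h => one_ne_zero (congrFun h 1)) h1 h2
  have hda := deh_natDegree_le ha
  have hdb := deh_natDegree_le hb
  generalize deh a = α at *
  generalize deh b = β at *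
  have hcop : IsCoprime α β := by
    rw [Polynomial.isCoprime_iff_aeval_ne_zero_of_isAlgClosed K K]
    intro t
    by_contra hc
    push Not at hc
    exact hne t (by simpa using hc.1) (by simpa using hc.2)
  have hw : Polynomial.wronskian α β ≠ 0 := by
    intro h
    obtain ⟨h1, h2⟩ := hcop.wronskian_eq_zero_iff.1 h
    have h1 := Polynomial.derivative_eq_zero.1 h1
    have h2 := Polynomial.derivative_eq_zero.1 h2
    exact hinf ⟨Polynomial.coeff_eq_zero_of_natDegree_lt (by omega),
      Polynomial.coeff_eq_zero_of_natDegree_lt (by omega)⟩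
  refine ⟨insert (α.coeff D / β.coeff D)
    ((S ∪ (Polynomial.wronskian α β).roots.toFinset).image fun t => α.eval t / β.eval t), ?_⟩
  intro c hc
  simp only [Finset.mem_insert, Finset.mem_image, not_or, not_exists, not_and] at hc
  obtain ⟨hc1, hc2⟩ := hc
  set P := α - Polynomial.C c * β with hP
  have hPD : P.coeff D ≠ 0 := by
    rw [hP, Polynomial.coeff_sub, Polynomial.coeff_C_mul]
    intro h
    by_cases h0 : β.coeff D = 0
    · exact hinf ⟨by simpa [h0] using h, h0⟩
    · apply hc1
      field_simp
      linear_combination -h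
  have hP0 : P ≠ 0 := fun h => hPD (by simp [h])
  have hdeg : P.natDegree = D := by
    apply le_antisymm
    · refine (Polynomial.natDegree_sub_le _ _).trans (max_le hda ?_)
      exact (Polynomial.natDegree_C_mul_le _ _).trans hdb
    · exact Polynomial.le_natDegree_of_ne_zero hPD
  have hroot : ∀ t, P.eval t = 0 → α.eval t = c * β.eval t ∧ β.eval t ≠ 0 ∧
      t ∉ S ∪ (Polynomial.wronskian α β).roots.toFinset := by
    intro t ht
    have h1 : α.eval t = c * β.eval t := by
      simp [hP] at ht
      linear_combination ht
    have h2 : β.eval t ≠ 0 := by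
      intro h
      exact hne t (by rw [h1, h, mul_zero]) h
    refine ⟨h1, h2, fun hm => hc2 t hm ?_⟩
    rw [h1]; field_simp
  have hnd : P.roots.Nodup := by
    rw [Multiset.nodup_iff_count_le_one]
    intro t
    rw [Polynomial.count_roots]
    by_contra hlt
    rw [not_le, Polynomial.one_lt_rootMultiplicity_iff_isRoot hP0] at hlt
    obtain ⟨h1, h2⟩ := hlt
    obtain ⟨h3, h4, h5⟩ := hroot t h1
    apply h5
    rw [Finset.mem_union, Multiset.mem_toFinset, Polynomial.mem_roots hw]
    right
    rw [Polynomial.IsRoot.def] at h2 ⊢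
    simp [hP] at h2
    simp [Polynomial.wronskian]
    rw [h3]
    linear_combination (-Polynomial.eval t β) * h2
  refine ⟨P.roots.toFinset, ?_, ?_⟩
  · rw [Multiset.toFinset_card_of_nodup hnd, ← hdeg]
    exact (IsAlgClosed.splits P).natDegree_eq_card_roots.symm
  · intro t ht
    rw [Multiset.mem_toFinset, Polynomial.mem_roots hP0] at ht
    obtain ⟨h3, h4, h5⟩ := hroot t ht
    exact ⟨h3, h4, fun h => h5 (Finset.mem_union_left _ h)⟩

theorem alg_indep {K : Type*} [Field K] [IsAlgClosed K] [CharZero K]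
    {G a b : MvPolynomial (Fin 2) K} {d D : ℕ} (hD : 0 < D)
    (hG : G.IsHomogeneous d) (hG0 : G ≠ 0)
    (ha : a.IsHomogeneous D) (hb : b.IsHomogeneous D)
    (hab : ∀ v : Fin 2 → K, v ≠ 0 → eval v a = 0 → eval v b = 0 → False)
    (r : MvPolynomial (Fin 2) K) (hr : aeval ![G * a, G * b] r = 0) : r = 0 := by
  classical
  have hg : deh G ≠ 0 := fun h => hG0 (deh_inj hG h)
  obtain ⟨B, hB⟩ := good_c hD ha hb hab (deh G).roots.toFinset
  have key : r * (X 1 * ∏ c ∈ B, (X 0 - C c * X 1)) = 0 := by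
    apply MvPolynomial.funext
    intro u
    rw [eval_mul, eval_mul, eval_prod, eval_X, map_zero]
    simp only [eval_sub, eval_mul, eval_X, eval_C]
    by_cases hu : u 1 = 0
    · simp [hu]
    by_cases hm : u 0 / u 1 ∈ B
    · rw [Finset.prod_eq_zero hm]
      · simp
      · field_simp; ring
    · obtain ⟨T, hT, hT'⟩ := hB _ hm
      obtain ⟨t, ht⟩ : T.Nonempty := by
        rw [← Finset.card_pos]; omega
      obtain ⟨h1, h2, h3⟩ := hT' t ht
      have h4 : (deh G).eval t ≠ 0 := by
        intro h
        apply h3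
        rw [Multiset.mem_toFinset, Polynomial.mem_roots hg]
        exact h
      obtain ⟨l, hl⟩ := IsAlgClosed.exists_pow_nat_eq (u 1 / ((deh G).eval t * (deh b).eval t))
        (show 0 < d + D by omega)
      rw [deh_eval] at h1 h2 h4
      rw [deh_eval, deh_eval] at hl
      rw [deh_eval] at h1
      have hev := congrArg (eval (fun i => l * (![1, t] : Fin 2 → K) i)) hr
      have e1 : eval (fun i => l * (![1, t] : Fin 2 → K) i) (aeval ![G * a, G * b] r)
          = eval u r := by
        rw [eval_aeval']
        congr 2
        ext i
        have q1 := eval_smul_homog hG l ![1, t]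
        have q2 := eval_smul_homog ha l ![1, t]
        have q3 := eval_smul_homog hb l ![1, t]
        fin_cases i
        · simp only [Fin.zero_eta, Matrix.cons_val_zero, eval_mul]
          rw [q1, q2, h1]
          field_simp at hl
          field_simp
          linear_combination (u 0) * hl
        · change eval _ (G * b) = u 1
          rw [eval_mul]
          rw [q1, q3]
          field_simp at hl
          linear_combination hl
      rw [e1, map_zero] at hev
      rw [hev, zero_mul]
  rcases mul_eq_zero.1 key with h | h
  · exact h
  · exfalso
    rcases mul_eq_zero.1 h with h | h
    · exact X_ne_zero _ h
    · obtain ⟨c, _, hc⟩ := Finset.prod_eq_zero_iff.1 h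
      have := congrArg (eval ![1, 0]) hc
      simp at this

theorem finSucc_eval₂ {K A : Type*} [Field K] [CommRing A] [Algebra K A] {m : ℕ} (g : Fin (m + 1) → A)
    (F : MvPolynomial (Fin (m + 1)) K) :
    (finSuccEquiv K m F).eval₂ (aeval (fun i : Fin m => g i.succ) : MvPolynomial (Fin m) K →ₐ[K] A).toRingHom
      (g 0) = aeval g F := by
  induction F using MvPolynomial.induction_on with
  | C a => simp [finSuccEquiv_apply]
  | add p q hp hq => rw [map_add, map_add, Polynomial.eval₂_add, hp, hq]
  | mul_X p i hp =>
    rw [map_mul, map_mul, Polynomial.eval₂_mul, hp, aeval_X]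
    congr 1
    refine Fin.cases ?_ (fun j => ?_) i
    · rw [finSuccEquiv_X_zero, Polynomial.eval₂_X]
    · rw [finSuccEquiv_X_succ, Polynomial.eval₂_C]
      simp

theorem exists_dep {K : Type*} [Field K] (α β φ γ : Polynomial K) (D d : ℕ) (hD : 0 < D)
    (hα : α.natDegree ≤ D) (hβ : β.natDegree ≤ D) (hφ : φ.natDegree ≤ D + d)
    (hγ : γ.natDegree ≤ d) :
    ∃ M : ℕ, ∃ g : Fin (D + 1) × Fin (M + 1) → K, (∃ x, g x ≠ 0) ∧
      ∑ x, g x • (α ^ (x.2 : ℕ) * β ^ (M + D - x.1 - x.2) * φ ^ (x.1 : ℕ) * γ ^ (D - x.1)) = 0 := by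
  classical
  refine ⟨D * (D + d), ?_⟩
  set M := D * (D + d) with hM
  let W := Polynomial.degreeLT K (D * (M + D + d) + 1)
  have hmem : ∀ x : Fin (D + 1) × Fin (M + 1),
      α ^ (x.2 : ℕ) * β ^ (M + D - x.1 - x.2) * φ ^ (x.1 : ℕ) * γ ^ (D - x.1) ∈ W := by
    rintro ⟨⟨j, hj⟩, ⟨i, hi⟩⟩
    rw [Polynomial.mem_degreeLT]
    refine lt_of_le_of_lt Polynomial.degree_le_natDegree ?_
    norm_cast
    rw [Nat.lt_succ_iff]
    obtain ⟨k, hk⟩ : ∃ k, i + k + j = M + D := ⟨M + D - j - i, by omega⟩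
    obtain ⟨l, hl⟩ : ∃ l, l + j = D := ⟨D - j, by omega⟩
    have e1 : M + D - j - i = k := by omega
    have e2 : D - j = l := by omega
    simp only [e1, e2]
    have h1 := Polynomial.natDegree_pow_le_of_le i hα
    have h2 := Polynomial.natDegree_pow_le_of_le k hβ
    have h3 := Polynomial.natDegree_pow_le_of_le j hφ
    have h4 := Polynomial.natDegree_pow_le_of_le l hγ
    refine (Polynomial.natDegree_mul_le_of_le (Polynomial.natDegree_mul_le_of_le
      (Polynomial.natDegree_mul_le_of_le h1 h2) h3) h4).trans (le_of_eq ?_)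
    calc i * D + k * D + j * (D + d) + l * d = (i + k + j) * D + (l + j) * d := by ring
      _ = (M + D) * D + D * d := by rw [hk, hl]
      _ = _ := by ring
  let v : Fin (D + 1) × Fin (M + 1) → W := fun x => ⟨_, hmem x⟩
  have hfin : Module.finrank K W = D * (M + D + d) + 1 := by
    rw [LinearEquiv.finrank_eq (Polynomial.degreeLTEquiv K _)]
    simp
  have : Module.Finite K W := Module.Finite.equiv (Polynomial.degreeLTEquiv K _).symm
  have hv : ¬ LinearIndependent K v := by
    intro h
    have := h.fintype_card_le_finrank
    rw [hfin] at this
    simp only [Fintype.card_prod, Fintype.card_fin] at this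
    have : D * (M + D + d) + D ≤ D * (M + D + d) := by
      have e : (D + 1) * (M + 1) = D * (M + D + d) + D + 1 := by
        have : D * (M + D + d) = D * M + M := by rw [hM]; ring
        rw [this]; ring
      omega
    omega
  rw [Fintype.not_linearIndependent_iff] at hv
  obtain ⟨g, hg, hne⟩ := hv
  refine ⟨g, hne, ?_⟩
  have := congrArg Subtype.val hg
  simpa [v] using this

theorem exists_H {K : Type*} [Field K] [Infinite K] {f₀ G a b : MvPolynomial (Fin 2) K} {d D : ℕ}
    (hD : 0 < D) (hf : f₀.IsHomogeneous (D + d))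
    (hG : G.IsHomogeneous d) (ha : a.IsHomogeneous D) (hb : b.IsHomogeneous D) :
    ∃ H : Polynomial (MvPolynomial (Fin 2) K), H ≠ 0 ∧ H.natDegree ≤ D ∧
      H.eval₂ (aeval ![G * a, G * b] : MvPolynomial (Fin 2) K →ₐ[K] MvPolynomial (Fin 2) K).toRingHom f₀ = 0 := by
  classical
  obtain ⟨M, g, ⟨⟨j₀, i₀⟩, hx⟩, hg⟩ := exists_dep (deh a) (deh b) (deh f₀) (deh G) D d hD
    (deh_natDegree_le ha) (deh_natDegree_le hb) (deh_natDegree_le hf) (deh_natDegree_le hG)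
  refine ⟨∑ x : Fin (D + 1) × Fin (M + 1), Polynomial.monomial (x.1 : ℕ)
    (monomial (Finsupp.single 0 (x.2 : ℕ) + Finsupp.single 1 (M + D - x.1 - x.2)) (g x)), ?_, ?_, ?_⟩
  · intro h0
    have h1 := congrArg (fun P => coeff (Finsupp.single 0 (i₀ : ℕ) + Finsupp.single 1 (M + D - j₀ - i₀))
      (Polynomial.coeff P (j₀ : ℕ))) h0
    simp only [Polynomial.finsetSum_coeff, Polynomial.coeff_zero, coeff_zero, coeff_sum] at h1
    rw [Finset.sum_eq_single (j₀, i₀)] at h1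
    · apply hx
      simpa using h1
    · rintro ⟨j, i⟩ _ hne
      rw [Polynomial.coeff_monomial]
      split_ifs with hj
      · rw [coeff_monomial, if_neg]
        intro he
        have := DFunLike.congr_fun he 0
        simp at this
        apply hne
        ext
        · exact hj
        · exact this
      · simp
    · simp
  · refine Polynomial.natDegree_sum_le_of_forall_le _ _ fun x _ => ?_
    refine (Polynomial.natDegree_monomial_le _).trans ?_
    have := x.1.isLt
    omega
  · have hev : (∑ x : Fin (D + 1) × Fin (M + 1), Polynomial.monomial (x.1 : ℕ)
        (monomial (Finsupp.single 0 (x.2 : ℕ) + Finsupp.single 1 (M + D - x.1 - x.2)) (g x))).eval₂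
        (aeval ![G * a, G * b] : MvPolynomial (Fin 2) K →ₐ[K] MvPolynomial (Fin 2) K).toRingHom f₀
        = ∑ x : Fin (D + 1) × Fin (M + 1), C (g x) * ((G * a) ^ (x.2 : ℕ) *
          (G * b) ^ (M + D - x.1 - x.2) * f₀ ^ (x.1 : ℕ)) := by
      rw [Polynomial.eval₂_finsetSum]
      refine Finset.sum_congr rfl fun x _ => ?_
      rw [Polynomial.eval₂_monomial]
      simp only [AlgHom.toRingHom_eq_coe, RingHom.coe_coe]
      rw [aeval_monomial, Finsupp.prod_add_index' (by simp) (by simp [pow_add])]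
      simp [algebraMap_eq]
      ring
    rw [hev]
    have hhom : (∑ x : Fin (D + 1) × Fin (M + 1), C (g x) * ((G * a) ^ (x.2 : ℕ) *
          (G * b) ^ (M + D - x.1 - x.2) * f₀ ^ (x.1 : ℕ))).IsHomogeneous ((D + d) * (M + D)) := by
      apply IsHomogeneous.sum
      rintro ⟨⟨j, hj⟩, ⟨i, hi⟩⟩ _
      apply IsHomogeneous.C_mul
      obtain ⟨k, hk⟩ : ∃ k, i + k + j = M + D := ⟨M + D - j - i, by omega⟩
      have e1 : M + D - j - i = k := by omega
      simp only [e1]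
      have := (((hG.mul ha).pow i).mul ((hG.mul hb).pow k)).mul (hf.pow j)
      convert this using 1
      rw [← hk]
      ring
    apply deh_inj hhom
    have : deh (∑ x : Fin (D + 1) × Fin (M + 1), C (g x) * ((G * a) ^ (x.2 : ℕ) *
          (G * b) ^ (M + D - x.1 - x.2) * f₀ ^ (x.1 : ℕ))) = (deh G) ^ M *
        ∑ x : Fin (D + 1) × Fin (M + 1), g x • (deh a ^ (x.2 : ℕ) * deh b ^ (M + D - x.1 - x.2) *
          deh f₀ ^ (x.1 : ℕ) * deh G ^ (D - x.1)) := by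
      rw [map_sum, Finset.mul_sum]
      refine Finset.sum_congr rfl ?_
      rintro ⟨⟨j, hj⟩, ⟨i, hi⟩⟩ _
      obtain ⟨k, hk⟩ : ∃ k, i + k + j = M + D := ⟨M + D - j - i, by omega⟩
      obtain ⟨l, hl⟩ : ∃ l, l + j = D := ⟨D - j, by omega⟩
      have e1 : M + D - j - i = k := by omega
      have e2 : D - j = l := by omega
      simp only [e1, e2]
      have e3 : i + k = M + l := by omega
      rw [Polynomial.smul_eq_C_mul, ← algebraMap_eq, map_mul, AlgHom.commutes, Polynomial.algebraMap_apply]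
      simp only [map_mul, map_pow, Algebra.algebraMap_self, RingHom.id_apply]
      have e4 : deh G ^ i * deh G ^ k = deh G ^ M * deh G ^ l := by
        rw [← pow_add, ← pow_add, e3]
      rw [mul_pow, mul_pow]
      linear_combination (Polynomial.C (g (⟨j, hj⟩, ⟨i, hi⟩)) * deh a ^ i * deh b ^ k * deh f₀ ^ j) * e4
    rw [this, hg, mul_zero]

theorem line_dvd {K : Type*} [Field K] (x : Fin 2 → MvPolynomial (Fin 2) K)
    (hx : ∀ r : MvPolynomial (Fin 2) K, aeval x r = 0 → r = 0)
    (f : Fin 3 → MvPolynomial (Fin 2) K) (l : Fin 3 → MvPolynomial (Fin 2) K)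
    (hl : ∀ i, f i = aeval x (l i)) (F : MvPolynomial (Fin 3) K) (hF : aeval f F = 0)
    (m : Fin 2 → MvPolynomial (Fin 3) K) (L : MvPolynomial (Fin 3) K)
    (hL : ∀ i, L ∣ X i - aeval m (l i)) : L ∣ F := by
  have h1 : aeval l F = 0 := by
    apply hx
    rw [← AlgHom.comp_apply, comp_aeval, ← hF]
    congr 2
    ext1 i
    exact (hl i).symm
  have h2 := aux_sub_mem (Ideal.span {L}) (fun i => aeval m (l i))
    (fun i => Ideal.mem_span_singleton.2 (hL i)) F
  have h3 : aeval (fun i => aeval m (l i)) F = 0 := by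
    rw [← comp_aeval, AlgHom.comp_apply, h1, map_zero]
  rw [h3, sub_zero] at h2
  exact Ideal.mem_span_singleton.1 h2

theorem not_lin_dvd {K : Type*} [Field K] {n : ℕ} (hn : 2 ≤ n) (F : MvPolynomial (Fin 3) K)
    (hFirr : Irreducible F) (hFhom : F.IsHomogeneous n) (i j : Fin 3) (c : K) 
    (h : (X i - C c * X j) ∣ F) (hij : i ≠ j) : False := by
  obtain ⟨q, hq⟩ := h
  have hL : (X i - C c * X j : MvPolynomial (Fin 3) K) ≠ 0 := by
    intro h
    have := congrArg (eval (fun k => if k = i then (1 : K) else 0)) h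
    simp [hij.symm] at this
  rcases hFirr.isUnit_or_isUnit hq with h | h
  · have := h.map (eval (fun _ => (0 : K)))
    simp at this
  · have hd : F ∣ (X i - C c * X j) := by
      obtain ⟨u, rfl⟩ := h
      exact ⟨↑u⁻¹, by rw [hq, mul_assoc, Units.mul_inv, mul_one]⟩
    have h1 := totalDegree_le_of_dvd_of_isDomain hd hL
    have h2 : (X i - C c * X j : MvPolynomial (Fin 3) K).IsHomogeneous 1 :=
      (isHomogeneous_X _ _).sub (isHomogeneous_C_mul_X _ _)
    rw [hFhom.totalDegree hFirr.ne_zero, h2.totalDegree hL] at h1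
    omega

theorem quot_homog {K : Type*} [Field K] {G a : MvPolynomial (Fin 2) K} {d n : ℕ}
    (hG : G.IsHomogeneous d) (hG0 : G ≠ 0) (h : (G * a).IsHomogeneous n) :
    a.IsHomogeneous (n - d) := by
  by_cases ha : a = 0
  · rw [ha]; exact isHomogeneous_zero _ _ _
  · have h0 : G * a ≠ 0 := mul_ne_zero hG0 ha
    obtain ⟨k, hk⟩ := homog_of_mul (mul_comm G a ▸ h) (mul_comm G a ▸ h0)
    have := (hG.mul hk).inj_right h h0
    have : n - d = k := by omega
    rwa [this]

theorem core {K : Type*} [Field K] [IsAlgClosed K] [CharZero K]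
    (n : ℕ) (hn : 2 ≤ n) (f : Fin 3 → MvPolynomial (Fin 2) K)
    (hf : ∀ i, (f i).IsHomogeneous n) (hnz : ∀ v : Fin 2 → K, v ≠ 0 → ∃ i, eval v (f i) ≠ 0)
    (S : Finset K) (hS : ∀ t₁, t₁ ∉ S → ∀ t₂, t₂ ∉ S → ∀ μ : K,
      (∀ i, eval ![1, t₁] (f i) = μ * eval ![1, t₂] (f i)) → t₁ = t₂)
    (F : MvPolynomial (Fin 3) K) (hFirr : Irreducible F) (hFhom : F.IsHomogeneous n)
    (hFf : aeval f F = 0) (G : MvPolynomial (Fin 2) K) (hG1 : G ∣ f 1) (hG2 : G ∣ f 2)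
    (hG : ∀ E, E ∣ f 1 → E ∣ f 2 → E ∣ G) :
    (finSuccEquiv K 2 F).natDegree + G.totalDegree = n := by
  classical
  have hvne : ∀ t : K, (![1, t] : Fin 2 → K) ≠ 0 := fun t h => one_ne_zero (congrFun h 0)
  -- `f 1`, `f 2` not both zero
  have hnot : f 1 ≠ 0 ∨ f 2 ≠ 0 := by
    by_contra hc
    push Not at hc
    obtain ⟨h1, h2⟩ := hc
    have h0 : ∀ t : K, eval ![1, t] (f 0) ≠ 0 := by
      intro t
      obtain ⟨i, hi⟩ := hnz _ (hvne t)
      fin_cases i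
      · exact hi
      · simp [h1] at hi
      · simp [h2] at hi
    obtain ⟨t₁, ht₁⟩ := Infinite.exists_notMem_finset S
    obtain ⟨t₂, ht₂⟩ := Infinite.exists_notMem_finset (insert t₁ S)
    rw [Finset.mem_insert, not_or] at ht₂
    apply ht₂.1
    refine hS t₂ ht₂.2 t₁ ht₁ (eval ![1, t₂] (f 0) / eval ![1, t₁] (f 0)) fun i => ?_
    fin_cases i
    · exact (div_mul_cancel₀ _ (h0 t₁)).symm
    · simp [h1]
    · simp [h2]
  obtain ⟨a, ha⟩ := hG1
  obtain ⟨b, hb⟩ := hG2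
  have hG0 : G ≠ 0 := by
    rintro rfl
    simp [ha, hb] at hnot
  have hGh : ∃ d, G.IsHomogeneous d ∧ d ≤ n := by
    rcases hnot with h | h
    · have h' := hf 1
      rw [ha] at h h'
      obtain ⟨d, hd⟩ := homog_of_mul h' h
      refine ⟨d, hd, ?_⟩
      rw [← hd.totalDegree hG0, ← h'.totalDegree h]
      exact totalDegree_le_of_dvd_of_isDomain (Dvd.intro _ rfl) h
    · have h' := hf 2
      rw [hb] at h h'
      obtain ⟨d, hd⟩ := homog_of_mul h' h
      refine ⟨d, hd, ?_⟩
      rw [← hd.totalDegree hG0, ← h'.totalDegree h]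
      exact totalDegree_le_of_dvd_of_isDomain (Dvd.intro _ rfl) h
  obtain ⟨d, hGd, hdn⟩ := hGh
  have hah : a.IsHomogeneous (n - d) := quot_homog hGd hG0 (ha ▸ hf 1)
  have hbh : b.IsHomogeneous (n - d) := quot_homog hGd hG0 (hb ▸ hf 2)
  rw [hGd.totalDegree hG0]
  obtain ⟨D, hDd⟩ : ∃ D, D + d = n := ⟨n - d, by omega⟩
  have hDe : n - d = D := by omega
  rw [hDe] at hah hbh
  have hcop : ∀ E, E ∣ a → E ∣ b → IsUnit E := by
    intro E h1 h2
    have h3 := hG (G * E) (ha ▸ mul_dvd_mul_left G h1) (hb ▸ mul_dvd_mul_left G h2)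
    rw [isUnit_iff_dvd_one]
    apply (mul_dvd_mul_iff_left hG0).1
    rwa [mul_one]
  have hab := no_common hah hbh hcop
  rcases Nat.eq_zero_or_pos D with hD0 | hD
  · -- the curve would be a line
    exfalso
    rw [hD0] at hah hbh
    obtain ⟨a₀, rfl⟩ : ∃ c, a = C c :=
      ⟨_, totalDegree_eq_zero_iff_eq_C.1 ((totalDegree_zero_iff_isHomogeneous _).2 hah)⟩
    obtain ⟨b₀, rfl⟩ : ∃ c, b = C c :=
      ⟨_, totalDegree_eq_zero_iff_eq_C.1 ((totalDegree_zero_iff_isHomogeneous _).2 hbh)⟩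
    by_cases hb0 : b₀ = 0
    · have ha0 : a₀ ≠ 0 := by
        intro h0
        exact hab ![1, 0] (hvne 0) (by simp [h0]) (by simp [hb0])
      have h2 : f 2 = 0 := by rw [hb, hb0]; simp
      have hind : ∀ r : MvPolynomial (Fin 2) K, aeval ![f 0, f 1] r = 0 → r = 0 := by
        intro r hr
        refine alg_indep (D := n) (by omega) (isHomogeneous_one _ _) one_ne_zero (hf 0) (hf 1) ?_ r
          (by simpa only [one_mul] using hr)
        intro v hv h0 h1
        obtain ⟨i, hi⟩ := hnz v hv
        fin_cases i
        · exact hi h0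
        · exact hi h1
        · simp [h2] at hi
      refine not_lin_dvd hn F hFirr hFhom 2 1 0 ?_ (by decide)
      refine line_dvd _ hind f ![X 0, X 1, 0] ?_ F hFf ![X 0, X 1] _ ?_
      · intro i; fin_cases i <;> simp [h2]
      · intro i; fin_cases i <;> simp
    · have h1 : f 1 = C (a₀ / b₀) * f 2 := by
        rw [ha, hb, mul_left_comm, ← C_mul, div_mul_cancel₀ _ hb0]
      have hind : ∀ r : MvPolynomial (Fin 2) K, aeval ![f 0, f 2] r = 0 → r = 0 := by
        intro r hr
        refine alg_indep (D := n) (by omega) (isHomogeneous_one _ _) one_ne_zero (hf 0) (hf 2) ?_ r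
          (by simpa only [one_mul] using hr)
        intro v hv h0 h2
        obtain ⟨i, hi⟩ := hnz v hv
        fin_cases i
        · exact hi h0
        · apply hi
          change eval v (f 1) = 0
          rw [h1, eval_mul, h2, mul_zero]
        · exact hi h2
      refine not_lin_dvd hn F hFirr hFhom 1 2 (a₀ / b₀) ?_ (by decide)
      refine line_dvd _ hind f ![X 0, C (a₀ / b₀) * X 1, X 1] ?_ F hFf ![X 0, X 2] _ ?_
      · intro i; fin_cases i
        · simp
        · simpa [algebraMap_eq] using h1
        · simp
      · intro i; fin_cases i <;> simp [algebraMap_eq]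
  -- main case
  have hfe : (fun i : Fin 2 => f i.succ) = ![G * a, G * b] := by
    ext1 i; fin_cases i
    · exact ha
    · exact hb
  have hle : (finSuccEquiv K 2 F).natDegree ≤ D := by
    obtain ⟨H, hH0, hHD, hH⟩ := exists_H (f₀ := f 0) hD (hDd ▸ hf 0) hGd hah hbh
    refine le_trans (gauss_deg _ ?_ _ _ ?_ (f 0) ?_ hH0 hH) hHD
    · rw [injective_iff_map_eq_zero]
      intro r hr
      exact alg_indep hD hGd hG0 hah hbh hab r hr
    · exact (MulEquiv.irreducible_iff (finSuccEquiv K 2).toMulEquiv).2 hFirr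
    · have := finSucc_eval₂ f F
      rw [hfe, hFf] at this
      exact this
  have hge : D ≤ (finSuccEquiv K 2 F).natDegree := by
    set N := (finSuccEquiv K 2 F).natDegree with hN
    have hFe0 : finSuccEquiv K 2 F ≠ 0 := by
      simpa using hFirr.ne_zero
    set lead := (finSuccEquiv K 2 F).coeff N with hlead
    have hlead0 : lead ≠ 0 := by
      rw [hlead, hN]
      exact Polynomial.leadingCoeff_ne_zero.2 hFe0
    have hleadh : lead.IsHomogeneous (n - N) :=
      hFhom.finSuccEquiv_coeff_isHomogeneous N (n - N) (by omega)
    have hld : deh lead ≠ 0 := fun h => hlead0 (deh_inj hleadh h)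
    have hg : deh G ≠ 0 := fun h => hG0 (deh_inj hGd h)
    obtain ⟨B, hB⟩ := good_c hD hbh hah (fun v hv h1 h2 => hab v hv h2 h1)
      (S ∪ (deh G).roots.toFinset)
    obtain ⟨c, hc⟩ := Infinite.exists_notMem_finset (B ∪ (deh lead).roots.toFinset)
    rw [Finset.mem_union, not_or, Multiset.mem_toFinset, Polynomial.mem_roots hld,
      Polynomial.IsRoot.def, deh_eval] at hc
    obtain ⟨hcB, hcl⟩ := hc
    obtain ⟨T, hT, hT'⟩ := hB c hcB
    set Q := (finSuccEquiv K 2 F).map (eval ![1, c]) with hQ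
    have hQN : Q.coeff N ≠ 0 := by
      rw [hQ, Polynomial.coeff_map]; exact hcl
    have hQ0 : Q ≠ 0 := fun h => hQN (by simp [h])
    have hQd : Q.natDegree ≤ N := Polynomial.natDegree_map_le
    have hQe : ∀ z, Q.eval z = eval ![z, 1, c] F := by
      intro z
      have := finSucc_eval₂ (A := K) ![z, 1, c] F
      rw [hQ, Polynomial.eval_map, ← aeval_eq_eval]
      refine Eq.trans ?_ this
      congr 1
    -- data at the points of `T`
    let m : K → K := fun t => eval ![1, t] G * eval ![1, t] a
    let z : K → K := fun t => eval ![1, t] (f 0) / m t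
    have hm : ∀ t ∈ T, m t ≠ 0 ∧ t ∉ S ∧ ∀ i, eval ![1, t] (f i) = m t * (![z t, 1, c] : Fin 3 → K) i := by
      intro t ht
      obtain ⟨h1, h2, h3⟩ := hT' t ht
      rw [Finset.mem_union, not_or, Multiset.mem_toFinset, Polynomial.mem_roots hg,
        Polynomial.IsRoot.def, deh_eval] at h3
      rw [deh_eval, deh_eval] at h1
      rw [deh_eval] at h2
      have hm0 : m t ≠ 0 := mul_ne_zero h3.2 h2
      refine ⟨hm0, h3.1, fun i => ?_⟩
      fin_cases i
      · exact (mul_div_cancel₀ _ hm0).symm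
      · change eval _ (f 1) = m t * 1
        rw [ha, eval_mul, mul_one]
      · change eval _ (f 2) = m t * c
        rw [hb, eval_mul, h1]
        change _ = eval ![1, t] G * eval ![1, t] a * c
        ring
    have hzr : ∀ t ∈ T, z t ∈ Q.roots.toFinset := by
      intro t ht
      obtain ⟨h1, h2, h3⟩ := hm t ht
      rw [Multiset.mem_toFinset, Polynomial.mem_roots hQ0, Polynomial.IsRoot.def, hQe]
      have h4 := congrArg (eval ![1, t]) hFf
      rw [eval_aeval', map_zero, _root_.funext h3, eval_smul_homog hFhom] at h4
      exact (mul_eq_zero.1 h4).resolve_left (pow_ne_zero _ h1)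
    have hzi : Set.InjOn z T := by
      intro t ht t' ht' he
      obtain ⟨h1, h2, h3⟩ := hm t ht
      obtain ⟨h1', h2', h3'⟩ := hm t' ht'
      refine hS t h2 t' h2' (m t / m t') fun i => ?_
      rw [h3, h3', he, ← mul_assoc, div_mul_cancel₀ _ h1']
    have hcard := Finset.card_le_card_of_injOn z hzr hzi
    rw [hT] at hcard
    refine hcard.trans ((Multiset.toFinset_card_le _).trans ((Polynomial.card_roots' Q).trans hQd))
  omega

theorem pointIdeal_e0 {K : Type*} [Field K] [Infinite K] :
    pointIdeal (![1, 0, 0] : Fin 3 → K) =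
      Ideal.span (Set.range fun i : Fin 2 => (X i.succ : MvPolynomial (Fin 3) K)) := by
  apply le_antisymm
  · refine Ideal.span_le.2 ?_
    rintro L ⟨hL, hL0⟩
    have h1 := aux_sub_mem (Ideal.span (Set.range fun i : Fin 2 =>
      (X i.succ : MvPolynomial (Fin 3) K))) ![X 0, 0, 0] (by
        intro i
        refine Fin.cases ?_ (fun j => ?_) i
        · simp
        · have : (![X 0, 0, 0] : Fin 3 → MvPolynomial (Fin 3) K) j.succ = 0 := by
            fin_cases j <;> rfl
          rw [this, sub_zero]
          exact Ideal.subset_span ⟨j, rfl⟩) L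
    have h2 : aeval (![X 0, 0, 0] : Fin 3 → MvPolynomial (Fin 3) K) L = 0 := by
      apply MvPolynomial.funext
      intro u
      rw [eval_aeval', map_zero]
      have : (fun i => eval u ((![X 0, 0, 0] : Fin 3 → MvPolynomial (Fin 3) K) i)) =
          fun i => u 0 * (![1, 0, 0] : Fin 3 → K) i := by
        ext1 i; fin_cases i <;> simp
      rw [this, eval_smul_homog hL, hL0, mul_zero]
    rwa [h2, sub_zero] at h1
  · refine Ideal.span_le.2 ?_
    rintro _ ⟨i, rfl⟩
    refine Ideal.subset_span ⟨isHomogeneous_X _ _, ?_⟩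
    fin_cases i <;> simp

theorem mem_pow_e0 {K : Type*} [Field K] [Infinite K] (F : MvPolynomial (Fin 3) K) (m : ℕ) :
    F ∈ pointIdeal (![1, 0, 0] : Fin 3 → K) ^ m ↔
      ∀ k, (finSuccEquiv K 2 F).coeff k ∈ idealOfVars (Fin 2) K ^ m := by
  have h1 : Ideal.map (finSuccEquiv K 2).toRingEquiv.toRingHom (pointIdeal (![1, 0, 0] : Fin 3 → K)) =
      Ideal.map Polynomial.C (idealOfVars (Fin 2) K) := by
    rw [pointIdeal_e0, idealOfVars, Ideal.map_span, Ideal.map_span, ← Set.range_comp,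
      ← Set.range_comp]
    congr 2
    ext1 i
    exact finSuccEquiv_X_succ
  rw [← Ideal.mem_map_C_iff, Ideal.map_pow, ← h1, ← Ideal.map_pow]
  constructor
  · exact fun h => Ideal.mem_map_of_mem _ h
  · intro h
    obtain ⟨x, hx, he⟩ := (Ideal.mem_map_iff_of_surjective
      (finSuccEquiv K 2).toRingEquiv.toRingHom (finSuccEquiv K 2).surjective).1 h
    have : x = F := (finSuccEquiv K 2).injective he
    exact this ▸ hx

theorem multAt_e0 {K : Type*} [Field K] [Infinite K] {n : ℕ} (F : MvPolynomial (Fin 3) K)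
    (hF0 : F ≠ 0) (hF : F.IsHomogeneous n) (hN : (finSuccEquiv K 2 F).natDegree ≤ n) :
    multAt F ![1, 0, 0] = n - (finSuccEquiv K 2 F).natDegree := by
  have : { m | F ∈ pointIdeal (![1, 0, 0] : Fin 3 → K) ^ m } =
      Set.Iic (n - (finSuccEquiv K 2 F).natDegree) := by
    ext m
    rw [Set.mem_ofPred_eq, mem_pow_e0, Set.mem_Iic]
    constructor
    · intro h
      have h1 := (mem_pow_idealOfVars_iff _ _).1 (h (finSuccEquiv K 2 F).natDegree)
      have h2 : (finSuccEquiv K 2 F).coeff (finSuccEquiv K 2 F).natDegree ≠ 0 :=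
        Polynomial.leadingCoeff_ne_zero.2 (by simpa using hF0)
      obtain ⟨x, hx⟩ := MvPolynomial.ne_zero_iff.1 h2
      have h3 := hF.finSuccEquiv_coeff_isHomogeneous (finSuccEquiv K 2 F).natDegree
        (n - (finSuccEquiv K 2 F).natDegree) (by omega)
      have h4 := h1 x (mem_support_iff.2 hx)
      have h5 := h3 hx
      replace h5 := (DFunLike.congr_fun Finsupp.degree_eq_weight_one x).trans h5
      exact h4.trans h5.le
    · intro h k
      rw [mem_pow_idealOfVars_iff]
      intro x hx
      have hx := mem_support_iff.1 hx
      have hk : k ≤ (finSuccEquiv K 2 F).natDegree := by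
        by_contra hk
        apply hx
        rw [Polynomial.coeff_eq_zero_of_natDegree_lt (by omega), coeff_zero]
      have h3 := hF.finSuccEquiv_coeff_isHomogeneous k (n - k) (by omega)
      have h5 := h3 hx
      replace h5 := (DFunLike.congr_fun Finsupp.degree_eq_weight_one x).trans h5
      rw [h5]
      omega
  rw [multAt, this, csSup_Iic]

/-- Linear substitution by a matrix. -/
def linSub {K : Type*} [Field K] (M : Matrix (Fin 3) (Fin 3) K) :
    MvPolynomial (Fin 3) K →ₐ[K] MvPolynomial (Fin 3) K :=
  aeval fun i => ∑ j, C (M i j) * X j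

theorem eval_linSub {K : Type*} [Field K] (M : Matrix (Fin 3) (Fin 3) K) (v : Fin 3 → K)
    (q : MvPolynomial (Fin 3) K) : eval v (linSub M q) = eval (M.mulVec v) q := by
  rw [linSub, eval_aeval']
  congr 2
  ext1 i
  simp [Matrix.mulVec, dotProduct]

theorem linSub_homog {K : Type*} [Field K] (M : Matrix (Fin 3) (Fin 3) K)
    {q : MvPolynomial (Fin 3) K} {n : ℕ} (hq : q.IsHomogeneous n) :
    (linSub M q).IsHomogeneous n := by
  have := hq.aeval (n := 1) (fun i => ∑ j, C (M i j) * X j : Fin 3 → MvPolynomial (Fin 3) K) (by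
    intro i
    refine IsHomogeneous.sum _ _ _ fun j _ => ?_
    simpa using (isHomogeneous_C (Fin 3) (M i j)).mul (isHomogeneous_X K j))
  rwa [one_mul] at this

theorem linSub_linSub {K : Type*} [Field K] [Infinite K] {A B : Matrix (Fin 3) (Fin 3) K}
    (h : A * B = 1) (q : MvPolynomial (Fin 3) K) : linSub B (linSub A q) = q := by
  apply MvPolynomial.funext
  intro v
  rw [eval_linSub, eval_linSub, Matrix.mulVec_mulVec, h, Matrix.one_mulVec]

theorem linSub_mem {K : Type*} [Field K] (M : Matrix (Fin 3) (Fin 3) K) {p q : Fin 3 → K}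
    (h : M.mulVec q = p) {F : MvPolynomial (Fin 3) K} {m : ℕ} (hF : F ∈ pointIdeal p ^ m) :
    linSub M F ∈ pointIdeal q ^ m := by
  have h1 : Ideal.map (linSub M).toRingHom (pointIdeal p) ≤ pointIdeal q := by
    rw [pointIdeal, Ideal.map_span, Ideal.span_le]
    rintro _ ⟨L, ⟨hL, hL0⟩, rfl⟩
    refine Ideal.subset_span ⟨linSub_homog M hL, ?_⟩
    have := eval_linSub M q L
    rw [h, hL0] at this
    exact this
  have h2 := Ideal.mem_map_of_mem (linSub M).toRingHom hF
  rw [Ideal.map_pow] at h2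
  exact Ideal.pow_right_mono h1 m h2

theorem multAt_linSub {K : Type*} [Field K] [Infinite K] {A B : Matrix (Fin 3) (Fin 3) K}
    (hAB : A * B = 1) {p q : Fin 3 → K} (h : A.mulVec q = p) (h' : B.mulVec p = q)
    (F : MvPolynomial (Fin 3) K) : multAt F p = multAt (linSub A F) q := by
  rw [multAt, multAt]
  congr 1
  ext m
  refine ⟨fun hm => linSub_mem A h hm, fun hm => ?_⟩
  have := linSub_mem B h' hm
  rwa [linSub_linSub hAB] at this

theorem linSub_irred {K : Type*} [Field K] [Infinite K] {A B : Matrix (Fin 3) (Fin 3) K}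
    (hAB : A * B = 1) (hBA : B * A = 1) {F : MvPolynomial (Fin 3) K} (hF : Irreducible F) :
    Irreducible (linSub A F) := by
  let e : MvPolynomial (Fin 3) K ≃* MvPolynomial (Fin 3) K :=
    { toFun := linSub A
      invFun := linSub B
      left_inv := linSub_linSub hAB
      right_inv := linSub_linSub hBA
      map_mul' := map_mul _ }
  exact (MulEquiv.irreducible_iff e).2 hF

theorem exists_mat {K : Type*} [Field K] (p : Fin 3 → K) (hp : p ≠ 0) :
    ∃ A B : Matrix (Fin 3) (Fin 3) K, A * B = 1 ∧ B * A = 1 ∧ A.mulVec ![1, 0, 0] = p := by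
  obtain ⟨i, hi⟩ := Function.ne_iff.1 hp
  suffices h : ∃ A : Matrix (Fin 3) (Fin 3) K, A.det ≠ 0 ∧ A.mulVec ![1, 0, 0] = p by
    obtain ⟨A, hA, h⟩ := h
    exact ⟨A, A⁻¹, Matrix.mul_nonsing_inv _ (isUnit_iff_ne_zero.2 hA),
      Matrix.nonsing_inv_mul _ (isUnit_iff_ne_zero.2 hA), h⟩
  fin_cases i
  · refine ⟨!![p 0, 0, 0; p 1, 1, 0; p 2, 0, 1], ?_, ?_⟩
    · simpa [Matrix.det_fin_three] using hi
    · ext j; fin_cases j <;> simp [Matrix.mulVec, dotProduct, Fin.sum_univ_three]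
  · refine ⟨!![p 0, 1, 0; p 1, 0, 0; p 2, 0, 1], ?_, ?_⟩
    · simpa [Matrix.det_fin_three] using hi
    · ext j; fin_cases j <;> simp [Matrix.mulVec, dotProduct, Fin.sum_univ_three]
  · refine ⟨!![p 0, 1, 0; p 1, 0, 1; p 2, 0, 0], ?_, ?_⟩
    · simpa [Matrix.det_fin_three] using hi
    · ext j; fin_cases j <;> simp [Matrix.mulVec, dotProduct, Fin.sum_univ_three]

theorem proper_finset {K : Type*} [Field K] {n : ℕ} {f : Fin 3 → MvPolynomial (Fin 2) K}
    (hf : IsProperParam n f) : ∃ S : Finset K, ∀ t₁, t₁ ∉ S → ∀ t₂, t₂ ∉ S → ∀ μ : K,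
      (∀ i, eval ![1, t₁] (f i) = μ * eval ![1, t₂] (f i)) → t₁ = t₂ := by
  have hvne : ∀ t : K, (![1, t] : Fin 2 → K) ≠ 0 := fun t h => one_ne_zero (congrFun h 0)
  let φ : K → Projectivization K (Fin 2 → K) := fun t => Projectivization.mk K ![1, t] (hvne t)
  have hφ : Function.Injective φ := by
    intro t t' h
    obtain ⟨a, ha⟩ := (Projectivization.mk_eq_mk_iff' K _ _ (hvne t) (hvne t')).1 h
    have h0 : a = 1 := by simpa using congrFun ha 0
    have h1 : a * t' = t := by simpa using congrFun ha 1
    rw [← h1, h0, one_mul]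
  have hproj : ∀ t, projMap f (φ t) =
      Projectivization.mk K (evalVec f ![1, t]) (hf.no_common_zero _ (hvne t)) := by
    intro t
    have hne := hf.no_common_zero _ (φ t).rep_nonzero
    rw [projMap, dif_pos hne, Projectivization.mk_eq_mk_iff']
    obtain ⟨a, ha⟩ := (Projectivization.mk_eq_mk_iff' K _ _ (φ t).rep_nonzero (hvne t)).1
      (Projectivization.mk_rep (φ t))
    refine ⟨a ^ n, ?_⟩
    ext i
    rw [← ha]
    exact (eval_smul_homog (hf.homog i) a ![1, t]).symm
  obtain ⟨S, hSf, hS⟩ := hf.gen_injective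
  have hfin : (φ ⁻¹' S).Finite := hSf.preimage hφ.injOn
  refine ⟨hfin.toFinset, fun t₁ h₁ t₂ h₂ μ h => ?_⟩
  rw [Set.Finite.mem_toFinset] at h₁ h₂
  apply hφ
  apply hS h₁ h₂
  rw [hproj, hproj, Projectivization.mk_eq_mk_iff']
  exact ⟨μ, _root_.funext fun i => (h i).symm⟩

theorem cross_dvd {K : Type*} [Field K] (f : Fin 3 → MvPolynomial (Fin 2) K)
    {A B : Matrix (Fin 3) (Fin 3) K} (hAB : A * B = 1) (hBA : B * A = 1) {p : Fin 3 → K}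
    (hp : p ≠ 0) (hA : ∀ i, A i 0 = p i) (E : MvPolynomial (Fin 2) K) :
    (∀ i j : Fin 3, i < j → E ∣ crossDiff f p i j) ↔
      (E ∣ ∑ j, C (B 1 j) * f j) ∧ (E ∣ ∑ j, C (B 2 j) * f j) := by
  constructor
  · intro h
    have h' : ∀ i j : Fin 3, E ∣ crossDiff f p i j := by
      intro i j
      rcases lt_trichotomy i j with hl | rfl | hl
      · exact h i j hl
      · simp [crossDiff]
      · have : crossDiff f p i j = - crossDiff f p j i := by simp [crossDiff]
        rw [this]; exact (h j i hl).neg_right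
    obtain ⟨k, hk⟩ := Function.ne_iff.1 hp
    have key : ∀ i : Fin 3, i ≠ 0 → E ∣ ∑ j, C (B i j) * f j := by
      intro i hi
      have h0 : ∑ j, B i j * p j = 0 := by
        have := congrFun (congrFun hBA i) 0
        rw [Matrix.mul_apply, Matrix.one_apply_ne hi] at this
        simpa only [hA] using this
      have h1 : ∑ j, C (B i j) * crossDiff f p k j = C (p k) * ∑ j, C (B i j) * f j := by
        have h2 : (∑ j, C (B i j) * C (p j) : MvPolynomial (Fin 2) K) = 0 := by
          simp only [← C_mul, ← map_sum, h0, map_zero]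
        calc ∑ j, C (B i j) * crossDiff f p k j
            = C (p k) * ∑ j, C (B i j) * f j - (∑ j, C (B i j) * C (p j)) * f k := by
              rw [Finset.mul_sum, Finset.sum_mul, ← Finset.sum_sub_distrib]
              refine Finset.sum_congr rfl fun j _ => ?_
              rw [crossDiff]; ring
          _ = _ := by rw [h2, zero_mul, sub_zero]
      have h3 : E ∣ C (p k) * ∑ j, C (B i j) * f j := by
        rw [← h1]
        exact Finset.dvd_sum fun j _ => (h' k j).mul_left _
      have h4 : (∑ j, C (B i j) * f j) = C (p k)⁻¹ * (C (p k) * ∑ j, C (B i j) * f j) := by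
        rw [← mul_assoc, ← C_mul, inv_mul_cancel₀ hk, C_1, one_mul]
      rw [h4]
      exact h3.mul_left _
    exact ⟨key 1 (by decide), key 2 (by decide)⟩
  · rintro ⟨h1, h2⟩ i j -
    have hfA : ∀ i, f i = ∑ l, C (A i l) * ∑ j, C (B l j) * f j := by
      intro i
      simp only [Finset.mul_sum, ← mul_assoc, ← C_mul]
      rw [Finset.sum_comm]
      simp only [← Finset.sum_mul, ← map_sum, ← Matrix.mul_apply, hAB, Matrix.one_apply]
      simp
    have hg : ∃ g : Fin 3 → MvPolynomial (Fin 2) K, ∀ l, g l = ∑ j, C (B l j) * f j :=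
      ⟨_, fun l => rfl⟩
    obtain ⟨g, hg⟩ := hg
    simp only [← hg] at hfA h1 h2
    obtain ⟨u, hu⟩ := h1
    obtain ⟨v, hv⟩ := h2
    rw [crossDiff, hfA i, hfA j, Fin.sum_univ_three, Fin.sum_univ_three, hA, hA, hu, hv]
    refine ⟨(C (p i) * C (A j 1) - C (p j) * C (A i 1)) * u +
      (C (p i) * C (A j 2) - C (p j) * C (A i 2)) * v, ?_⟩
    ring

theorem main_aux {K : Type*} [Field K] [IsAlgClosed K] [CharZero K]
    (n : ℕ) (hn : 3 ≤ n) (f : Fin 3 → MvPolynomial (Fin 2) K)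
    (hf : IsProperParam n f)
    (F : MvPolynomial (Fin 3) K) (hFirr : Irreducible F) (hFhom : F.IsHomogeneous n)
    (hFf : MvPolynomial.aeval f F = 0)
    (p : Fin 3 → K) (hp : p ≠ 0)
    (G : MvPolynomial (Fin 2) K) (hG : IsGcdOfCross f p G) :
    multAt F p = G.totalDegree := by
  obtain ⟨A, B, hAB, hBA, hAp⟩ := exists_mat p hp
  have hBp : B.mulVec p = ![1, 0, 0] := by
    rw [← hAp, Matrix.mulVec_mulVec, hBA, Matrix.one_mulVec]
  have hA : ∀ i, A i 0 = p i := by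
    intro i
    rw [← hAp]
    simp [Matrix.mulVec, dotProduct, Fin.sum_univ_three]
  obtain ⟨f', hf'⟩ : ∃ f' : Fin 3 → MvPolynomial (Fin 2) K, ∀ i, f' i = ∑ j, C (B i j) * f j :=
    ⟨_, fun i => rfl⟩
  have hev : ∀ v : Fin 2 → K, (fun i => eval v (f' i)) = B.mulVec fun i => eval v (f i) := by
    intro v
    ext1 i
    simp [hf', Matrix.mulVec, dotProduct]
  have hev' : ∀ v : Fin 2 → K, (fun i => eval v (f i)) = A.mulVec fun i => eval v (f' i) := by
    intro v
    rw [hev, Matrix.mulVec_mulVec, hAB, Matrix.one_mulVec]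
  have hdvd := cross_dvd f hAB hBA hp hA
  obtain ⟨S, hS⟩ := proper_finset hf
  have hcore := core n (by omega) f' (by
      intro i
      rw [hf']
      refine IsHomogeneous.sum _ _ _ fun j _ => ?_
      simpa using (isHomogeneous_C (Fin 2) (B i j)).mul (hf.homog j)) (by
      intro v hv
      by_contra hc
      push Not at hc
      apply hf.no_common_zero v hv
      change (fun i => eval v (f i)) = 0
      rw [hev', _root_.funext hc]
      exact Matrix.mulVec_zero A) S (by
      intro t₁ h₁ t₂ h₂ μ h
      refine hS t₁ h₁ t₂ h₂ μ fun i => ?_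
      have h3 : (fun i => eval ![1, t₁] (f' i)) = μ • fun i => eval ![1, t₂] (f' i) :=
        _root_.funext h
      have h4 := hev' ![1, t₁]
      rw [h3, Matrix.mulVec_smul, ← hev'] at h4
      exact congrFun h4 i) (linSub A F) (linSub_irred hAB hBA hFirr) (linSub_homog A hFhom) (by
      apply MvPolynomial.funext
      intro v
      rw [eval_aeval', eval_linSub, ← hev', ← eval_aeval', hFf]) G
    (by rw [hf']; exact ((hdvd G).1 hG.1).1) (by rw [hf']; exact ((hdvd G).1 hG.1).2) (by
      intro E h1 h2
      rw [hf'] at h1 h2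
      exact hG.2 E ((hdvd E).2 ⟨h1, h2⟩))
  rw [multAt_linSub hAB hAp hBp F,
    multAt_e0 _ (linSub_irred hAB hBA hFirr).ne_zero (linSub_homog A hFhom) (by omega)]
  omega

/-- For every point `P ∈ ℙ²(K)`, the multiplicity of `C` at `P` equals the degree of a gcd
`G_P` of the three cross differences `p_i f_j - p_j f_i`. In particular `m_P(C) = 0` exactly
when `G_P` is constant, and `P` is singular exactly when `deg G_P ≥ 2`. -/
theorem statement_3 {K : Type*} [Field K] [IsAlgClosed K] [CharZero K]
    (n : ℕ) (hn : 3 ≤ n) (f : Fin 3 → MvPolynomial (Fin 2) K)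
    (hf : IsProperParam n f)
    (F : MvPolynomial (Fin 3) K) (hFirr : Irreducible F) (hFhom : F.IsHomogeneous n)
    (hFf : MvPolynomial.aeval f F = 0)
    (p : Fin 3 → K) (hp : p ≠ 0)
    (G : MvPolynomial (Fin 2) K) (hG : IsGcdOfCross f p G) :
    multAt F p = G.totalDegree ∧
    (multAt F p = 0 ↔ ∃ c : K, G = MvPolynomial.C c) ∧
    (2 ≤ multAt F p ↔ 2 ≤ G.totalDegree) := by

  have h := main_aux n hn f hf F hFirr hFhom hFf p hp G hG
  refine ⟨h, ?_, by rw [h]⟩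
  rw [h]
  constructor
  · exact fun h0 => ⟨_, totalDegree_eq_zero_iff_eq_C.1 h0⟩
  · rintro ⟨c, rfl⟩
    exact totalDegree_C c

end
end
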